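/- arXiv:2506.22475 — 17 statements merged into one kernel-verified Lean document; each statement's English description precedes it below -/
import Mathlib

section
/- For every n ≥ 1, the Segments Equal Sharing method f^{Se} satisfies additivity, efficiency, the inessential segment property, and segment symmetry; and it is the unique toll allocation method satisfying these four properties, i.e. any toll allocation method f satisfying all four satisfies f(N,T) = f^{Se}(N,T) for every toll matrix T. -/
open Finset

/-- `T` is an `n × n` one-way toll matrix on the segments `{1, …, n}`:
entries are nonnegative, entries below the diagonal vanish, and entries
outside `{1,…,n} × {1,…,n}` vanish. -/
def IsTollMatrix (n : ℕ) (T : ℕ → ℕ → ℝ) : Prop :=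
  (∀ h k, 0 ≤ T h k) ∧ (∀ h k, k < h → T h k = 0) ∧
    (∀ h k, h < 1 ∨ n < h ∨ k < 1 ∨ n < k → T h k = 0)
/-- A toll allocation method assigns a nonnegative share to every segment. -/
def IsMethod (n : ℕ) (f : (ℕ → ℕ → ℝ) → ℕ → ℝ) : Prop :=
  ∀ T, IsTollMatrix n T → ∀ i ∈ Finset.Icc 1 n, 0 ≤ f T i
/-- The Segments Equal Sharing (SES) method:
`f^{Se}_i(N,T) = Σ_{h=1}^{i} Σ_{k=i}^{n} t_{hk}/(k−h+1)`. -/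
noncomputable def SES (n : ℕ) (T : ℕ → ℕ → ℝ) (i : ℕ) : ℝ :=
  ∑ h ∈ Finset.Icc 1 i, ∑ k ∈ Finset.Icc i n, T h k / ((k : ℝ) - (h : ℝ) + 1)
/-- Efficiency: the total collected toll is fully distributed. -/
def Efficient (n : ℕ) (f : (ℕ → ℕ → ℝ) → ℕ → ℝ) : Prop :=
  ∀ T, IsTollMatrix n T →
    ∑ i ∈ Finset.Icc 1 n, f T i = ∑ h ∈ Finset.Icc 1 n, ∑ k ∈ Finset.Icc h n, T h k
/-- Inessential segment property: a segment used by no trip gets nothing. -/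
def InessentialSegment (n : ℕ) (f : (ℕ → ℕ → ℝ) → ℕ → ℝ) : Prop :=
  ∀ T, IsTollMatrix n T → ∀ i ∈ Finset.Icc 1 n,
    (∀ h k, 1 ≤ h → h ≤ i → i ≤ k → k ≤ n → T h k = 0) → f T i = 0
/-- Additivity. -/
def AdditiveMethod (n : ℕ) (f : (ℕ → ℕ → ℝ) → ℕ → ℝ) : Prop :=
  ∀ T T', IsTollMatrix n T → IsTollMatrix n T' →
    ∀ i ∈ Finset.Icc 1 n, f (fun h k => T h k + T' h k) i = f T i + f T' i
/-- Segment symmetry: segments belonging to every positively tolled trip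
receive the same share. -/
def SegmentSymmetric (n : ℕ) (f : (ℕ → ℕ → ℝ) → ℕ → ℝ) : Prop :=
  ∀ T, IsTollMatrix n T → ∀ i ∈ Finset.Icc 1 n, ∀ j ∈ Finset.Icc 1 n,
    (∀ h k, 1 ≤ h → h ≤ k → k ≤ n → 0 < T h k →
      i ∈ Finset.Icc h k ∧ j ∈ Finset.Icc h k) →
    f T i = f T j

lemma SES_eq_ite (n : ℕ) (T : ℕ → ℕ → ℝ) (i : ℕ) (hi : i ∈ Finset.Icc 1 n) :
    SES n T i = ∑ h ∈ Finset.Icc 1 n, ∑ k ∈ Finset.Icc 1 n,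
      if h ≤ i ∧ i ≤ k then T h k / ((k : ℝ) - (h : ℝ) + 1) else 0 := by
  rw [Finset.mem_Icc] at hi
  unfold SES
  have e1 : Finset.Icc 1 i = (Finset.Icc 1 n).filter (fun h => h ≤ i) := by
    ext x; simp only [Finset.mem_Icc, Finset.mem_filter]; omega
  have e2 : Finset.Icc i n = (Finset.Icc 1 n).filter (fun k => i ≤ k) := by
    ext x; simp only [Finset.mem_Icc, Finset.mem_filter]; omega
  rw [e1, e2, Finset.sum_filter]
  refine Finset.sum_congr rfl fun h _ => ?_
  by_cases hh : h ≤ i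
  · simp [hh, Finset.sum_filter]
  · simp [hh]

lemma SES_additive (n : ℕ) : AdditiveMethod n (SES n) := by
  intro T T' _ _ i _
  simp only [SES, add_div, Finset.sum_add_distrib]

lemma SES_inessential (n : ℕ) : InessentialSegment n (SES n) := by
  intro T _ i _ h0
  unfold SES
  refine Finset.sum_eq_zero fun h hh => Finset.sum_eq_zero fun k hk => ?_
  rw [Finset.mem_Icc] at hh hk
  rw [h0 h k hh.1 hh.2 hk.1 hk.2, zero_div]

lemma SES_symm (n : ℕ) : SegmentSymmetric n (SES n) := by
  intro T hT i hi j hj hs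
  rw [SES_eq_ite n T i hi, SES_eq_ite n T j hj]
  refine Finset.sum_congr rfl fun h hh => Finset.sum_congr rfl fun k hk => ?_
  rw [Finset.mem_Icc] at hh hk
  rcases (hT.1 h k).eq_or_lt with h0 | h0
  · simp [← h0]
  · have hle : h ≤ k := by
      by_contra hc
      rw [hT.2.1 h k (by omega)] at h0
      exact lt_irrefl _ h0
    have := hs h k hh.1 hle hk.2 h0
    simp only [Finset.mem_Icc] at this
    rw [if_pos this.1, if_pos this.2]

lemma SES_efficient (n : ℕ) : Efficient n (SES n) := by
  intro T hT
  rw [Finset.sum_congr rfl (fun i hi => SES_eq_ite n T i hi), Finset.sum_comm]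
  refine Finset.sum_congr rfl fun h hh => ?_
  rw [Finset.mem_Icc] at hh
  rw [Finset.sum_comm]
  have e2 : Finset.Icc h n = (Finset.Icc 1 n).filter (fun k => h ≤ k) := by
    ext x; simp only [Finset.mem_Icc, Finset.mem_filter]; omega
  rw [e2, Finset.sum_filter]
  refine Finset.sum_congr rfl fun k hk => ?_
  rw [Finset.mem_Icc] at hk
  rw [← Finset.sum_filter]
  have e3 : (Finset.Icc 1 n).filter (fun i => h ≤ i ∧ i ≤ k) = Finset.Icc h k := by
    ext x; simp only [Finset.mem_Icc, Finset.mem_filter]; omega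
  rw [e3, Finset.sum_const, Nat.card_Icc, nsmul_eq_mul]
  split_ifs with hle
  · have : (0 : ℝ) ≤ (k : ℝ) - h := by
      rw [sub_nonneg]; exact_mod_cast hle
    rw [Nat.cast_sub (by omega)]
    push_cast
    rw [show (k : ℝ) + 1 - h = k - h + 1 by ring]
    exact mul_div_cancel₀ _ (by linarith) 
  · rw [hT.2.1 h k (by omega)]; simp

/-- The matrix `T` restricted to the entries in `S`. -/
noncomputable def restrictToll (T : ℕ → ℕ → ℝ) (S : Finset (ℕ × ℕ)) : ℕ → ℕ → ℝ :=
  fun h k => if (h, k) ∈ S then T h k else 0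

lemma restrictToll_isToll {n : ℕ} {T : ℕ → ℕ → ℝ} (hT : IsTollMatrix n T)
    (S : Finset (ℕ × ℕ)) : IsTollMatrix n (restrictToll T S) := by
  refine ⟨fun h k => ?_, fun h k hk => ?_, fun h k hk => ?_⟩ <;> unfold restrictToll
  · split_ifs
    · exact hT.1 h k
    · exact le_rfl
  · rw [hT.2.1 h k hk, ite_self]
  · rw [hT.2.2 h k hk, ite_self]

/-- The share on a single-trip matrix. -/
lemma share_single {n : ℕ} {f : (ℕ → ℕ → ℝ) → ℕ → ℝ} (he : Efficient n f)
    (hi0 : InessentialSegment n f) (hs : SegmentSymmetric n f)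
    {T : ℕ → ℕ → ℝ} (hT : IsTollMatrix n T) (a b : ℕ) (ha : 1 ≤ a) (hab : a ≤ b) (hb : b ≤ n)
    (hz : ∀ h k, (h, k) ≠ (a, b) → T h k = 0) (i : ℕ) (hi : i ∈ Finset.Icc a b) :
    ((Finset.Icc a b).card : ℝ) * f T i
      = ∑ h ∈ Finset.Icc 1 n, ∑ k ∈ Finset.Icc h n, T h k := by
  rw [← he T hT, ← nsmul_eq_mul, ← Finset.sum_const]
  have hsub : Finset.Icc a b ⊆ Finset.Icc 1 n := Finset.Icc_subset_Icc ha hb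
  rw [← Finset.sum_subset hsub]
  · refine Finset.sum_congr rfl fun j hj => ?_
    refine hs T hT i (hsub hi) j (hsub hj) fun h k _ _ _ hpos => ?_
    by_cases hp : (h, k) = (a, b)
    · obtain ⟨rfl, rfl⟩ := Prod.mk.inj hp
      exact ⟨hi, hj⟩
    · rw [hz h k hp] at hpos
      exact absurd hpos (lt_irrefl _)
  · intro j hj hjn
    refine hi0 T hT j hj fun h k _ h2 h3 _ => hz h k fun hp => hjn ?_
    obtain ⟨rfl, rfl⟩ := Prod.mk.inj hp
    exact Finset.mem_Icc.2 ⟨h2, h3⟩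

lemma unique_single {n : ℕ} {f g : (ℕ → ℕ → ℝ) → ℕ → ℝ} (he : Efficient n f)
    (hi0 : InessentialSegment n f) (hs : SegmentSymmetric n f) (ge : Efficient n g)
    (gi0 : InessentialSegment n g) (gs : SegmentSymmetric n g)
    {T : ℕ → ℕ → ℝ} (hT : IsTollMatrix n T) (a b : ℕ)
    (hz : ∀ h k, (h, k) ≠ (a, b) → T h k = 0) (i : ℕ) (hi : i ∈ Finset.Icc 1 n) :
    f T i = g T i := by
  by_cases hc : i ∈ Finset.Icc a b ∧ T a b ≠ 0
  · obtain ⟨hm, hne⟩ := hc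
    have hab : a ≤ b := by
      by_contra hc; exact hne (hT.2.1 a b (by omega))
    have hr : ¬ (a < 1 ∨ n < a ∨ b < 1 ∨ n < b) := fun hc => hne (hT.2.2 a b hc)
    have h1 := share_single he hi0 hs hT a b (by omega) hab (by omega) hz i hm
    have h2 := share_single ge gi0 gs hT a b (by omega) hab (by omega) hz i hm
    have hpos : ((Finset.Icc a b).card : ℝ) ≠ 0 := by
      exact_mod_cast (Finset.card_pos.2 ⟨i, hm⟩).ne'
    exact mul_left_cancel₀ hpos (h1.trans h2.symm)
  · have key : ∀ h k, 1 ≤ h → h ≤ i → i ≤ k → k ≤ n → T h k = 0 := by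
      intro h k _ h2 h3 _
      by_cases hp : (h, k) = (a, b)
      · obtain ⟨rfl, rfl⟩ := Prod.mk.inj hp
        by_contra hne
        exact hc ⟨Finset.mem_Icc.2 ⟨h2, h3⟩, hne⟩
      · exact hz h k hp
    rw [hi0 T hT i hi key, gi0 T hT i hi key]

lemma unique_restrict {n : ℕ} {f g : (ℕ → ℕ → ℝ) → ℕ → ℝ} (ha : AdditiveMethod n f)
    (he : Efficient n f)
    (hi0 : InessentialSegment n f) (hs : SegmentSymmetric n f) (ga : AdditiveMethod n g)
    (ge : Efficient n g)
    (gi0 : InessentialSegment n g) (gs : SegmentSymmetric n g)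
    {T : ℕ → ℕ → ℝ} (hT : IsTollMatrix n T) (i : ℕ) (hi : i ∈ Finset.Icc 1 n)
    (S : Finset (ℕ × ℕ)) : f (restrictToll T S) i = g (restrictToll T S) i := by
  induction S using Finset.induction_on with
  | empty =>
    have hT0 := restrictToll_isToll hT ∅
    rw [hi0 _ hT0 i hi (fun _ _ _ _ _ _ => by simp [restrictToll]),
      gi0 _ hT0 i hi (fun _ _ _ _ _ _ => by simp [restrictToll])]
  | insert p S hp ih =>
    have hsplit : restrictToll T (insert p S)
        = fun h k => restrictToll T {p} h k + restrictToll T S h k := by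
      funext h k
      simp only [restrictToll, Finset.mem_insert, Finset.mem_singleton]
      by_cases h1 : (h, k) = p
      · have h2 : (h, k) ∉ S := h1 ▸ hp
        simp [h1, hp]
      · simp [h1]
    have t1 := restrictToll_isToll hT {p}
    have t2 := restrictToll_isToll hT S
    rw [hsplit, ha _ _ t1 t2 i hi, ga _ _ t1 t2 i hi, ih]
    rw [unique_single he hi0 hs ge gi0 gs t1 p.1 p.2 (fun h k hne => ?_) i hi]
    have : (h, k) ≠ p := hne
    simp [restrictToll, this]

/-- The SES method satisfies additivity, efficiency, the inessential segment
property and segment symmetry, and it is the unique toll allocation method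
satisfying these four properties. -/
theorem SES_characterization_four_axioms (n : ℕ) (hn : 1 ≤ n) :
    (AdditiveMethod n (SES n) ∧ Efficient n (SES n) ∧ InessentialSegment n (SES n) ∧
      SegmentSymmetric n (SES n)) ∧
    ∀ f, IsMethod n f → AdditiveMethod n f → Efficient n f → InessentialSegment n f →
      SegmentSymmetric n f →
      ∀ T, IsTollMatrix n T → ∀ i ∈ Finset.Icc 1 n, f T i = SES n T i := by
  refine ⟨⟨SES_additive n, SES_efficient n, SES_inessential n, SES_symm n⟩, ?_⟩
  intro f _ ha he hi0 hs T hT i hi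
  have key := unique_restrict ha he hi0 hs (SES_additive n) (SES_efficient n)
    (SES_inessential n) (SES_symm n) hT i hi (Finset.Icc 1 n ×ˢ Finset.Icc 1 n)
  have hfull : restrictToll T (Finset.Icc 1 n ×ˢ Finset.Icc 1 n) = T := by
    funext h k
    unfold restrictToll
    split_ifs with hm
    · rfl
    · rw [hT.2.2 h k]
      simp only [Finset.mem_product, Finset.mem_Icc] at hm
      omega
  rwa [hfull] at key
end

section
/- For every n ≥ 1, the Segments Equal Sharing method f^{Se} satisfies toll fairness and sub-highway efficiency, and it is the unique toll allocation method satisfying these two properties. -/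
open Finset

/-- Toll fairness. -/
def TollFairness (n : ℕ) (f : (ℕ → ℕ → ℝ) → ℕ → ℝ) : Prop :=
  ∀ T T', IsTollMatrix n T → IsTollMatrix n T' → ∀ i, 1 ≤ i → i < n →
    (∀ h k, 1 ≤ h → h ≤ k → k ≤ n →
      ((k ≤ i ∨ i + 1 ≤ h) → T' h k = T h k) ∧ (h ≤ i → i < k → T' h k = 0)) →
    f T i - f T' i = f T (i + 1) - f T' (i + 1)
/-- `Finset.Icc a b` (a set of consecutive segments) is a sub-highway of `T`. -/
def IsSubHighway (n : ℕ) (T : ℕ → ℕ → ℝ) (a b : ℕ) : Prop :=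
  1 ≤ a ∧ a ≤ b ∧ b ≤ n ∧
    ∀ i j, 1 ≤ i → i ≤ j → j ≤ n →
      (Finset.Icc i j ∩ Finset.Icc a b).Nonempty →
      ¬(i ∈ Finset.Icc a b ∧ j ∈ Finset.Icc a b) → T i j = 0

/-- Sub-highway efficiency. -/
def SubHighwayEfficient (n : ℕ) (f : (ℕ → ℕ → ℝ) → ℕ → ℝ) : Prop :=
  ∀ T, IsTollMatrix n T → ∀ a b, IsSubHighway n T a b →
    ∑ i ∈ Finset.Icc a b, f T i = ∑ h ∈ Finset.Icc a b, ∑ k ∈ Finset.Icc h b, T h k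

lemma SES_eq (n : ℕ) (T : ℕ → ℕ → ℝ) (i : ℕ) (h1 : 1 ≤ i) (h2 : i ≤ n) :
    SES n T i = ∑ h ∈ Finset.Icc 1 n, ∑ k ∈ Finset.Icc 1 n,
      if h ≤ i ∧ i ≤ k then T h k / ((k : ℝ) - (h : ℝ) + 1) else 0 := by
  unfold SES
  have e1 : Finset.Icc 1 i = (Finset.Icc 1 n).filter (fun h => h ≤ i) := by
    ext x; simp only [Finset.mem_Icc, Finset.mem_filter]; omega
  have e2 : Finset.Icc i n = (Finset.Icc 1 n).filter (fun k => i ≤ k) := by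
    ext x; simp only [Finset.mem_Icc, Finset.mem_filter]; omega
  rw [e1, e2, Finset.sum_filter]
  refine Finset.sum_congr rfl fun h _ => ?_
  rw [Finset.sum_filter]
  by_cases hh : h ≤ i <;> simp [hh]

lemma SES_fair (n : ℕ) : TollFairness n (SES n) := by
  intro T T' hT hT' i h1 h2 H
  rw [SES_eq n T i h1 h2.le, SES_eq n T' i h1 h2.le, SES_eq n T (i+1) (by omega) h2,
    SES_eq n T' (i+1) (by omega) h2]
  simp only [← Finset.sum_sub_distrib]
  refine Finset.sum_congr rfl fun h hh => Finset.sum_congr rfl fun k hk => ?_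
  rw [Finset.mem_Icc] at hh hk
  by_cases hkh : k < h
  · simp [hT.2.1 h k hkh, hT'.2.1 h k hkh]
  · by_cases hc : h ≤ i ∧ i < k
    · have c1 : h ≤ i ∧ i ≤ k := by omega
      have c2 : h ≤ i + 1 ∧ i + 1 ≤ k := by omega
      rw [if_pos c1, if_pos c1, if_pos c2, if_pos c2]
    · have := (H h k hh.1 (by omega) hk.2).1 (by omega)
      rw [this]; simp

lemma SES_eff (n : ℕ) : SubHighwayEfficient n (SES n) := by
  intro T hT a b ⟨ha, hab, hb, H⟩
  have L : ∑ i ∈ Finset.Icc a b, SES n T i = ∑ h ∈ Finset.Icc 1 n, ∑ k ∈ Finset.Icc 1 n,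
      ∑ i ∈ Finset.Icc a b, if h ≤ i ∧ i ≤ k then T h k / ((k : ℝ) - (h : ℝ) + 1) else 0 := by
    rw [Finset.sum_congr rfl (fun i hi => SES_eq n T i
      (by rw [Finset.mem_Icc] at hi; omega) (by rw [Finset.mem_Icc] at hi; omega))]
    rw [Finset.sum_comm]
    refine Finset.sum_congr rfl fun h _ => ?_
    rw [Finset.sum_comm]
  have R : ∑ h ∈ Finset.Icc a b, ∑ k ∈ Finset.Icc h b, T h k = ∑ h ∈ Finset.Icc 1 n,
      ∑ k ∈ Finset.Icc 1 n, if (a ≤ h ∧ h ≤ b) ∧ (h ≤ k ∧ k ≤ b) then T h k else 0 := by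
    have e1 : Finset.Icc a b = (Finset.Icc 1 n).filter (fun h => a ≤ h ∧ h ≤ b) := by
      ext x; simp only [Finset.mem_Icc, Finset.mem_filter]; omega
    rw [e1, Finset.sum_filter]
    refine Finset.sum_congr rfl fun h hh => ?_
    rw [Finset.mem_Icc] at hh
    have e2 : Finset.Icc h b = (Finset.Icc 1 n).filter (fun k => h ≤ k ∧ k ≤ b) := by
      ext x; simp only [Finset.mem_Icc, Finset.mem_filter]; omega
    rw [e2, Finset.sum_filter]
    by_cases hc : a ≤ h ∧ h ≤ b <;> simp [hc]
  rw [L, R]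
  refine Finset.sum_congr rfl fun h hh => Finset.sum_congr rfl fun k hk => ?_
  rw [Finset.mem_Icc] at hh hk
  by_cases h0 : T h k = 0
  · simp [h0]
  have hkh : h ≤ k := by
    by_contra hc
    exact h0 (hT.2.1 h k (by omega))
  by_cases hE : a ≤ h ∧ k ≤ b
  · rw [if_pos (by omega), ← Finset.sum_filter]
    have e : (Finset.Icc a b).filter (fun i => h ≤ i ∧ i ≤ k) = Finset.Icc h k := by
      ext x; simp only [Finset.mem_Icc, Finset.mem_filter]; omega
    rw [e, Finset.sum_const, Nat.card_Icc, nsmul_eq_mul, Nat.cast_sub (by omega)]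
    have : (h : ℝ) ≤ k := by exact_mod_cast hkh
    have : (k : ℝ) - h + 1 ≠ 0 := by linarith
    push_cast
    field_simp
    ring
  · rw [if_neg (by omega)]
    refine Finset.sum_eq_zero fun i hi => ?_
    rw [Finset.mem_Icc] at hi
    rw [if_neg]
    intro hc
    refine h0 (H h k hh.1 hkh hk.2 ⟨i, ?_⟩ ?_)
    · simp only [Finset.mem_inter, Finset.mem_Icc]; omega
    · simp only [Finset.mem_Icc]; omega

lemma left_end (C : ℕ → Prop) (h0 : ¬ C 0) (i : ℕ) (hi : 1 ≤ i) :
    ∃ a, 1 ≤ a ∧ a ≤ i ∧ ¬ C (a - 1) ∧ ∀ j, a ≤ j → j < i → C j := by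
  induction i, hi using Nat.le_induction with
  | base => exact ⟨1, le_rfl, le_rfl, h0, fun j _ _ => by omega⟩
  | succ i hi ih =>
    by_cases hC : C i
    · obtain ⟨a, h1, h2, h3, h4⟩ := ih
      refine ⟨a, h1, by omega, h3, fun j hj hj' => ?_⟩
      rcases Nat.lt_succ_iff_lt_or_eq.mp hj' with h | h
      · exact h4 j hj h
      · exact h ▸ hC
    · exact ⟨i + 1, by omega, le_rfl, hC, fun j _ _ => by omega⟩

lemma right_end (C : ℕ → Prop) (n : ℕ) (h0 : ¬ C n) (i : ℕ) (hi : i ≤ n) :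
    ∃ b, i ≤ b ∧ b ≤ n ∧ ¬ C b ∧ ∀ j, i ≤ j → j < b → C j := by
  classical
  have hex : ∃ b, i ≤ b ∧ ¬ C b := ⟨n, hi, h0⟩
  refine ⟨Nat.find hex, (Nat.find_spec hex).1, Nat.find_min' hex ⟨hi, h0⟩,
    (Nat.find_spec hex).2, fun j hj hj' => ?_⟩
  have := Nat.find_min hex hj'
  tauto

open Classical in
lemma SES_unique (n : ℕ) (f : (ℕ → ℕ → ℝ) → ℕ → ℝ) (hF : TollFairness n f)
    (hE : SubHighwayEfficient n f) (m : ℕ) :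
    ∀ T, IsTollMatrix n T →
      ((Finset.Icc 1 n ×ˢ Finset.Icc 1 n).filter (fun p : ℕ × ℕ => T p.1 p.2 ≠ 0)).card = m →
      ∀ i ∈ Finset.Icc 1 n, f T i = SES n T i := by
  induction m using Nat.strong_induction_on with
  | _ m ih =>
  intro T hT hm i hi
  rw [Finset.mem_Icc] at hi
  set C : ℕ → Prop := fun j => ∃ h k, h ≤ j ∧ j < k ∧ T h k ≠ 0 with hC
  have inb : ∀ h k, T h k ≠ 0 → 1 ≤ h ∧ h ≤ k ∧ k ≤ n := by
    intro h k hne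
    refine ⟨?_, ?_, ?_⟩ <;> by_contra hc
    · exact hne (hT.2.2 h k (by omega))
    · exact hne (hT.2.1 h k (by omega))
    · exact hne (hT.2.2 h k (by omega))
  have C0 : ¬ C 0 := by
    rintro ⟨h, k, h1, h2, h3⟩
    have := inb h k h3
    omega
  have Cn : ¬ C n := by
    rintro ⟨h, k, h1, h2, h3⟩
    have := inb h k h3
    omega
  have step : ∀ j, C j → f T j - SES n T j = f T (j+1) - SES n T (j+1) := by
    rintro j ⟨h, k, h1, h2, h3⟩
    have hb := inb h k h3
    let T' : ℕ → ℕ → ℝ := fun h k => if h ≤ j ∧ j < k then 0 else T h k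
    have hT' : IsTollMatrix n T' := by
      refine ⟨fun x y => ?_, fun x y hxy => ?_, fun x y hxy => ?_⟩ <;> simp only [T'] <;> split_ifs
      · exact le_rfl
      · exact hT.1 x y
      · rfl
      · exact hT.2.1 x y hxy
      · rfl
      · exact hT.2.2 x y hxy
    have lt : ((Finset.Icc 1 n ×ˢ Finset.Icc 1 n).filter
        (fun p : ℕ × ℕ => T' p.1 p.2 ≠ 0)).card < m := by
      rw [← hm]
      apply Finset.card_lt_card
      rw [Finset.ssubset_iff_of_subset]
      · refine ⟨(h, k), ?_, ?_⟩
        · simp only [Finset.mem_filter, Finset.mem_product, Finset.mem_Icc]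
          exact ⟨by omega, h3⟩
        · simp [T', h1, h2]
      · intro p hp
        simp only [Finset.mem_filter, T'] at hp ⊢
        refine ⟨hp.1, fun h0 => hp.2 ?_⟩
        simp [h0]
    have cond : ∀ h k, 1 ≤ h → h ≤ k → k ≤ n →
      ((k ≤ j ∨ j + 1 ≤ h) → T' h k = T h k) ∧ (h ≤ j → j < k → T' h k = 0) := by
      intro x y _ _ _
      refine ⟨fun hx => if_neg (by omega), fun hx hy => if_pos ⟨hx, hy⟩⟩
    have A := hF T T' hT hT' j (by omega) (by omega) cond
    have B := SES_fair n T T' hT hT' j (by omega) (by omega) cond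
    have I1 := ih _ lt T' hT' rfl j (by rw [Finset.mem_Icc]; omega)
    have I2 := ih _ lt T' hT' rfl (j+1) (by rw [Finset.mem_Icc]; omega)
    linarith
  obtain ⟨a, a1, a2, a3, a4⟩ := left_end C C0 i hi.1
  obtain ⟨b, b1, b2, b3, b4⟩ := right_end C n Cn i hi.2
  have hab : ∀ j, a ≤ j → j < b → C j := by
    intro j h1 h2
    rcases lt_or_ge j i with h | h
    · exact a4 j h1 h
    · exact b4 j h h2
  have const : ∀ j, a ≤ j → j ≤ b → f T j - SES n T j = f T a - SES n T a := by
    intro j hj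
    induction j, hj using Nat.le_induction with
    | base => intro _; rfl
    | succ j hj ihj =>
      intro hjb
      rw [← step j (hab j hj hjb), ihj (by omega)]
  have hsub : IsSubHighway n T a b := by
    refine ⟨a1, by omega, b2, fun x y hx hxy hy hne hnot => ?_⟩
    by_contra h0
    obtain ⟨z, hz⟩ := hne
    simp only [Finset.mem_inter, Finset.mem_Icc] at hz hnot
    by_cases hxa : x < a
    · exact a3 ⟨x, y, by omega, by omega, h0⟩
    · exact b3 ⟨x, y, by omega, by omega, h0⟩
  have S : ∑ j ∈ Finset.Icc a b, (f T j - SES n T j) = 0 := by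
    rw [Finset.sum_sub_distrib, hE T hT a b hsub, SES_eff n T hT a b hsub, sub_self]
  rw [Finset.sum_congr rfl (fun j hj => const j (Finset.mem_Icc.mp hj).1 (Finset.mem_Icc.mp hj).2),
    Finset.sum_const, Nat.card_Icc, nsmul_eq_mul] at S
  have hpos : ((b + 1 - a : ℕ) : ℝ) ≠ 0 := by
    rw [Nat.cast_ne_zero]; omega
  have := (mul_eq_zero.mp S).resolve_left hpos
  have := const i a2 b1
  linarith

/-- The SES method satisfies toll fairness and sub-highway efficiency, and it
is the unique toll allocation method satisfying these two properties. -/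
theorem SES_characterization_fairness (n : ℕ) (hn : 1 ≤ n) :
    (TollFairness n (SES n) ∧ SubHighwayEfficient n (SES n)) ∧
    ∀ f, IsMethod n f → TollFairness n f → SubHighwayEfficient n f →
      ∀ T, IsTollMatrix n T → ∀ i ∈ Finset.Icc 1 n, f T i = SES n T i := by
  refine ⟨⟨SES_fair n, SES_eff n⟩, fun f _ hF hE T hT => SES_unique n f hF hE _ T hT rfl⟩
end

section
/- For every n ≥ 1 and every toll matrix T, the Segments Equal Sharing allocation coincides with the Shapley value of the segments allocation game: f^{Se}_i(N,T) = Sh_i(N, v^{Se}) for all i ∈ N. -/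
open Finset

/-- The segments allocation game: `v^{Se}(S) = Σ_{h≤k, 𝒫([h,k]) ⊆ S} t_{hk}`. -/
def vSe (n : ℕ) (T : ℕ → ℕ → ℝ) (S : Finset ℕ) : ℝ :=
  ∑ h ∈ Finset.Icc 1 n, ∑ k ∈ Finset.Icc h n, if Finset.Icc h k ⊆ S then T h k else 0

/-- The Shapley value of a TU-game on the player set `{1,…,n}`. -/
noncomputable def Shapley (n : ℕ) (v : Finset ℕ → ℝ) (i : ℕ) : ℝ :=
  ∑ S ∈ ((Finset.Icc 1 n).erase i).powerset,
    ((S.card.factorial * (n - S.card - 1).factorial : ℕ) : ℝ) / (n.factorial : ℝ) *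
      (v (insert i S) - v S)

lemma count_aux (m q : ℕ) :
    (∑ r ∈ Finset.range (m + 1), m.choose r * ((q + r).factorial * (m - r).factorial)) * (q + 1)
      = (m + q + 1).factorial := by
  have h1 : ∀ r ∈ Finset.range (m + 1),
      m.choose r * ((q + r).factorial * (m - r).factorial)
        = m.factorial * q.factorial * (r + q).choose q := by
    intro r hr
    have hr' : r ≤ m := by
      have := Finset.mem_range.mp hr
      omega
    have e1 := Nat.choose_mul_factorial_mul_factorial hr'
    have e2 := Nat.choose_mul_factorial_mul_factorial (Nat.le_add_left q r)
    rw [Nat.add_sub_cancel] at e2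
    rw [add_comm q r, ← e2, ← e1]
    ring
  rw [Finset.sum_congr rfl h1, ← Finset.mul_sum, Nat.sum_range_add_choose]
  have e3 := Nat.choose_mul_factorial_mul_factorial (show q + 1 ≤ m + q + 1 by omega)
  rw [show m + q + 1 - (q + 1) = m by omega, Nat.factorial_succ q] at e3
  rw [← e3]
  ring

lemma unanimity_aux (n : ℕ) (N P : Finset ℕ) (hN : N.card = n) (hP : P ⊆ N) (i : ℕ) (hi : i ∈ P) :
    ∑ S ∈ (N.erase i).powerset, (if P.erase i ⊆ S then
      ((S.card.factorial * (n - S.card - 1).factorial : ℕ) : ℝ) / (n.factorial : ℝ) else 0)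
      = 1 / (P.card : ℝ) := by
  obtain ⟨q, hq⟩ : ∃ q, P.card = q + 1 :=
    ⟨P.card - 1, by have := Finset.card_pos.mpr ⟨i, hi⟩; omega⟩
  have hqc : (P.erase i).card = q := by rw [Finset.card_erase_of_mem hi]; omega
  have hm : (N \ P).card = n - (q + 1) := by rw [Finset.card_sdiff_of_subset hP, hN, hq]
  have hle : q + 1 ≤ n := by rw [← hq, ← hN]; exact Finset.card_le_card hP
  obtain ⟨m, rfl⟩ : ∃ m, n = m + q + 1 := ⟨n - (q + 1), by omega⟩
  have hm' : (N \ P).card = m := by omega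
  rw [← Finset.sum_filter]
  have key : ∑ S ∈ (N.erase i).powerset with P.erase i ⊆ S,
      (((S.card.factorial * (m + q + 1 - S.card - 1).factorial : ℕ) : ℝ) /
        ((m + q + 1).factorial : ℝ))
      = ∑ R ∈ (N \ P).powerset, (((q + R.card).factorial * (m - R.card).factorial : ℕ) : ℝ) /
        ((m + q + 1).factorial : ℝ) := by
    symm
    refine Finset.sum_bij' (fun R _ => P.erase i ∪ R) (fun S _ => S \ P.erase i) ?_ ?_ ?_ ?_ ?_
    · intro R hR
      simp only [Finset.mem_filter, Finset.mem_powerset] at hR ⊢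
      refine ⟨?_, Finset.subset_union_left⟩
      intro x hx
      have h1 := @hP x
      have h2 := @hR x
      simp only [Finset.mem_union, Finset.mem_erase, Finset.mem_sdiff] at *
      grind
    · intro S hS
      simp only [Finset.mem_filter, Finset.mem_powerset] at hS ⊢
      intro x hx
      have h1 := @hS.1 x
      simp only [Finset.mem_erase, Finset.mem_sdiff] at *
      grind
    · intro R hR
      rw [Finset.mem_powerset] at hR
      ext x
      have h2 := @hR x
      simp only [Finset.mem_union, Finset.mem_erase, Finset.mem_sdiff] at *
      grind
    · intro S hS
      simp only [Finset.mem_filter] at hS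
      exact Finset.union_sdiff_of_subset hS.2
    · intro R hR
      rw [Finset.mem_powerset] at hR
      have hd : Disjoint (P.erase i) R := by
        rw [Finset.disjoint_left]
        intro x hx hxR
        exact (Finset.mem_sdiff.mp (hR hxR)).2 (Finset.mem_of_mem_erase hx)
      rw [Finset.card_union_of_disjoint hd, hqc,
        show m + q + 1 - (q + R.card) - 1 = m - R.card by omega]
  rw [key, Finset.sum_powerset_apply_card
    (fun r => (((q + r).factorial * (m - r).factorial : ℕ) : ℝ) / ((m + q + 1).factorial : ℝ)),
    hm', hq]
  have hc := congrArg (Nat.cast : ℕ → ℝ) (count_aux m q)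
  have hf : ((m + q + 1).factorial : ℝ) ≠ 0 := by exact_mod_cast Nat.factorial_ne_zero _
  have hq0 : ((q + 1 : ℕ) : ℝ) ≠ 0 := by positivity
  rw [eq_div_iff hq0]
  simp only [nsmul_eq_mul, ← mul_div_assoc]
  rw [← Finset.sum_div, div_mul_eq_mul_div, div_eq_iff hf, one_mul, ← hc]
  push_cast
  rfl

/-- The SES allocation coincides with the Shapley value of the segments
allocation game. -/
theorem SES_eq_Shapley (n : ℕ) (hn : 1 ≤ n) (T : ℕ → ℕ → ℝ)
    (hT : IsTollMatrix n T) :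
    ∀ i ∈ Finset.Icc 1 n, SES n T i = Shapley n (vSe n T) i := by
  intro i hi
  have hi' := Finset.mem_Icc.mp hi
  have hmarg : ∀ S ∈ ((Finset.Icc 1 n).erase i).powerset,
      ((S.card.factorial * (n - S.card - 1).factorial : ℕ) : ℝ) / (n.factorial : ℝ) *
        (vSe n T (insert i S) - vSe n T S)
      = ∑ h ∈ Finset.Icc 1 n, ∑ k ∈ Finset.Icc h n, (if i ∈ Finset.Icc h k then T h k else 0) *
          (if (Finset.Icc h k).erase i ⊆ S then
            ((S.card.factorial * (n - S.card - 1).factorial : ℕ) : ℝ) / (n.factorial : ℝ)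
            else 0) := by
    intro S hS
    have hiS : i ∉ S := fun h => by
      have := Finset.mem_powerset.mp hS h
      simp at this
    unfold vSe
    rw [← Finset.sum_sub_distrib, Finset.mul_sum]
    refine Finset.sum_congr rfl fun h _ => ?_
    rw [← Finset.sum_sub_distrib, Finset.mul_sum]
    refine Finset.sum_congr rfl fun k _ => ?_
    simp only [Finset.subset_insert_iff]
    by_cases hm : i ∈ Finset.Icc h k
    · have h2 : ¬ Finset.Icc h k ⊆ S := fun hs => hiS (hs hm)
      rw [if_neg h2, if_pos hm]
      split_ifs <;> ring
    · rw [if_neg hm, Finset.erase_eq_of_notMem hm]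
      ring
  unfold Shapley
  rw [Finset.sum_congr rfl hmarg, Finset.sum_comm]
  have hin : ∀ h ∈ Finset.Icc 1 n,
      ∑ S ∈ ((Finset.Icc 1 n).erase i).powerset, ∑ k ∈ Finset.Icc h n,
        (if i ∈ Finset.Icc h k then T h k else 0) *
          (if (Finset.Icc h k).erase i ⊆ S then
            ((S.card.factorial * (n - S.card - 1).factorial : ℕ) : ℝ) / (n.factorial : ℝ)
            else 0)
      = if h ≤ i then ∑ k ∈ Finset.Icc i n, T h k / ((k : ℝ) - (h : ℝ) + 1) else 0 := by
    intro h hh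
    have hh' := Finset.mem_Icc.mp hh
    rw [Finset.sum_comm]
    have h3 : ∀ k ∈ Finset.Icc h n, ∑ S ∈ ((Finset.Icc 1 n).erase i).powerset,
        (if i ∈ Finset.Icc h k then T h k else 0) *
          (if (Finset.Icc h k).erase i ⊆ S then
            ((S.card.factorial * (n - S.card - 1).factorial : ℕ) : ℝ) / (n.factorial : ℝ)
            else 0)
        = if i ∈ Finset.Icc h k then T h k / ((k : ℝ) - (h : ℝ) + 1) else 0 := by
      intro k hk
      have hk' := Finset.mem_Icc.mp hk
      rw [← Finset.mul_sum]
      by_cases hm : i ∈ Finset.Icc h k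
      · rw [unanimity_aux n (Finset.Icc 1 n) (Finset.Icc h k) (by simp)
          (Finset.Icc_subset_Icc hh'.1 hk'.2) i hm, if_pos hm, if_pos hm, Nat.card_Icc,
          Nat.cast_sub (by omega)]
        push_cast
        rw [mul_one_div]
        congr 1
        ring
      · rw [if_neg hm, if_neg hm, zero_mul]
    rw [Finset.sum_congr rfl h3, ← Finset.sum_filter]
    split_ifs with hle
    · refine Finset.sum_congr ?_ fun _ _ => rfl
      ext k
      simp only [Finset.mem_filter, Finset.mem_Icc]
      omega
    · rw [Finset.filter_false_of_mem, Finset.sum_empty]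
      intro k _
      simp only [Finset.mem_Icc]
      omega
  rw [Finset.sum_congr rfl hin, ← Finset.sum_filter]
  unfold SES
  refine Finset.sum_congr ?_ fun _ _ => rfl
  ext h
  simp only [Finset.mem_filter, Finset.mem_Icc]
  omega
end

section
/- For every n ≥ 1, the Segments Proportional Sharing method f^{Sp} satisfies efficiency, the inessential segment property, weighted segment symmetry, and covariance; and it is the unique toll allocation method satisfying these four properties, i.e. any toll allocation method f satisfying all four satisfies f(N,T) = f^{Sp}(N,T) for every toll matrix T. -/
open Finset

/-- Total toll collected over all the trips using segment `i`. -/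
def tripTollAt (n : ℕ) (T : ℕ → ℕ → ℝ) (i : ℕ) : ℝ :=
  ∑ h ∈ Finset.Icc 1 i, ∑ k ∈ Finset.Icc i n, T h k

/-- `D(T) = Σ_{j=1}^{n} (Σ_{h=1}^{j} Σ_{k=j}^{n} t_{hk} − t_{jj})`. -/
def Dsep (n : ℕ) (T : ℕ → ℕ → ℝ) : ℝ :=
  ∑ j ∈ Finset.Icc 1 n, (tripTollAt n T j - T j j)

/-- The Segments Proportional Sharing (SPS) method. -/
noncomputable def SPS (n : ℕ) (T : ℕ → ℕ → ℝ) (i : ℕ) : ℝ :=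
  if 0 < Dsep n T then
    T i i + (tripTollAt n T i - T i i) / Dsep n T *
      ((∑ h ∈ Finset.Icc 1 n, ∑ k ∈ Finset.Icc h n, T h k) - ∑ j ∈ Finset.Icc 1 n, T j j)
  else T i i
/-- Segment `i` is essential in `T` if some positively tolled trip uses it. -/
def Essential (n : ℕ) (T : ℕ → ℕ → ℝ) (i : ℕ) : Prop :=
  ∃ h k, 1 ≤ h ∧ h ≤ i ∧ i ≤ k ∧ k ≤ n ∧ 0 < T h k

/-- Weighted segment symmetry (stated multiplicatively):
`f_i(N,T) · Σ_{h≤j≤k} t_{hk} = f_j(N,T) · Σ_{h≤i≤k} t_{hk}`. -/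
def WeightedSegmentSymmetric (n : ℕ) (f : (ℕ → ℕ → ℝ) → ℕ → ℝ) : Prop :=
  ∀ T, IsTollMatrix n T → (∀ i, 1 ≤ i → i ≤ n → T i i = 0) →
    ∀ i ∈ Finset.Icc 1 n, ∀ j ∈ Finset.Icc 1 n, Essential n T i → Essential n T j →
      f T i * tripTollAt n T j = f T j * tripTollAt n T i

/-- Covariance. -/
def CovariantMethod (n : ℕ) (f : (ℕ → ℕ → ℝ) → ℕ → ℝ) : Prop :=
  ∀ T T', IsTollMatrix n T → IsTollMatrix n T' → ∀ b : ℝ, 0 ≤ b → ∀ a : ℕ → ℝ,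
    (∀ i j, 1 ≤ i → i ≤ n → 1 ≤ j → j ≤ n → i ≠ j → T' i j = b * T i j) →
    (∀ i, 1 ≤ i → i ≤ n → T' i i = b * T i i + a i) →
    ∀ i ∈ Finset.Icc 1 n, f T' i = b * f T i + a i

lemma icc_ite (n i : ℕ) (a : ℕ → ℝ) (h1 : 1 ≤ i) (h2 : i ≤ n) :
    ∑ h ∈ Finset.Icc 1 i, ∑ k ∈ Finset.Icc i n, (if h = k then a h else 0) = a i := by
  rw [Finset.sum_eq_single i]
  · rw [Finset.sum_eq_single i] <;> simp +contextual [eq_comm, h2]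
  · intro h hh hne
    apply Finset.sum_eq_zero
    intro k hk
    simp only [Finset.mem_Icc] at hh hk
    rw [if_neg (by omega)]
  · intro h; simp at h; omega

lemma trip_cov {n : ℕ} {T T' : ℕ → ℕ → ℝ} {b : ℝ} {a : ℕ → ℝ}
    (h1 : ∀ i j, 1 ≤ i → i ≤ n → 1 ≤ j → j ≤ n → i ≠ j → T' i j = b * T i j)
    (h2 : ∀ i, 1 ≤ i → i ≤ n → T' i i = b * T i i + a i) {i : ℕ} (hi : i ∈ Finset.Icc 1 n) :
    tripTollAt n T' i = b * tripTollAt n T i + a i := by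
  obtain ⟨hi1, hi2⟩ := Finset.mem_Icc.1 hi
  unfold tripTollAt
  rw [← icc_ite n i a hi1 hi2, Finset.mul_sum, ← Finset.sum_add_distrib]
  refine Finset.sum_congr rfl fun h hh => ?_
  rw [Finset.mul_sum, ← Finset.sum_add_distrib]
  refine Finset.sum_congr rfl fun k hk => ?_
  simp only [Finset.mem_Icc] at hh hk
  split_ifs with he
  · subst he; exact h2 h (by omega) (by omega)
  · rw [h1 h k (by omega) (by omega) (by omega) (by omega) he, add_zero]

lemma total_cov {n : ℕ} {T T' : ℕ → ℕ → ℝ} {b : ℝ} {a : ℕ → ℝ}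
    (h1 : ∀ i j, 1 ≤ i → i ≤ n → 1 ≤ j → j ≤ n → i ≠ j → T' i j = b * T i j)
    (h2 : ∀ i, 1 ≤ i → i ≤ n → T' i i = b * T i i + a i) :
    (∑ h ∈ Finset.Icc 1 n, ∑ k ∈ Finset.Icc h n, T' h k) - ∑ j ∈ Finset.Icc 1 n, T' j j =
    b * ((∑ h ∈ Finset.Icc 1 n, ∑ k ∈ Finset.Icc h n, T h k) - ∑ j ∈ Finset.Icc 1 n, T j j) := by
  rw [← Finset.sum_sub_distrib, ← Finset.sum_sub_distrib, Finset.mul_sum]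
  refine Finset.sum_congr rfl fun h hh => ?_
  simp only [Finset.mem_Icc] at hh
  have e : ∑ k ∈ Finset.Icc h n, T' h k
      = ∑ k ∈ Finset.Icc h n, (b * T h k + if h = k then a h else 0) := by
    refine Finset.sum_congr rfl fun k hk => ?_
    simp only [Finset.mem_Icc] at hk
    split_ifs with he
    · subst he; exact h2 h (by omega) (by omega)
    · rw [h1 h k (by omega) (by omega) (by omega) (by omega) he, add_zero]
  rw [e, Finset.sum_add_distrib, ← Finset.mul_sum, Finset.sum_ite_eq,
    if_pos (Finset.mem_Icc.2 ⟨le_rfl, hh.2⟩), h2 h hh.1 hh.2]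
  ring

lemma row_le_trip {n : ℕ} {T : ℕ → ℕ → ℝ} (hT : IsTollMatrix n T) {i : ℕ}
    (hi : i ∈ Finset.Icc 1 n) : ∑ k ∈ Finset.Icc i n, T i k ≤ tripTollAt n T i :=
  Finset.single_le_sum (f := fun h => ∑ k ∈ Finset.Icc i n, T h k)
    (fun h _ => Finset.sum_nonneg fun k _ => hT.1 h k)
    (Finset.mem_Icc.2 ⟨(Finset.mem_Icc.1 hi).1, le_rfl⟩)

lemma diag_le_row {n : ℕ} {T : ℕ → ℕ → ℝ} (hT : IsTollMatrix n T) {i : ℕ}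
    (hi : i ∈ Finset.Icc 1 n) : T i i ≤ ∑ k ∈ Finset.Icc i n, T i k :=
  Finset.single_le_sum (f := fun k => T i k) (fun k _ => hT.1 i k)
    (Finset.mem_Icc.2 ⟨le_rfl, (Finset.mem_Icc.1 hi).2⟩)

lemma sps_eff (n : ℕ) : Efficient n (SPS n) := by
  intro T hT
  have hD : Dsep n T = ∑ j ∈ Finset.Icc 1 n, (tripTollAt n T j - T j j) := rfl
  unfold SPS
  split_ifs with h
  · rw [Finset.sum_add_distrib, ← Finset.sum_mul, ← Finset.sum_div, ← hD, div_self h.ne']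
    ring
  · have a1 := Finset.sum_le_sum fun i hi => row_le_trip hT (i := i) hi
    have a2 := Finset.sum_le_sum fun i hi => diag_le_row hT (i := i) hi
    rw [Finset.sum_sub_distrib] at hD
    linarith

lemma trip_zero {n : ℕ} {T : ℕ → ℕ → ℝ} {i : ℕ}
    (h : ∀ h k, 1 ≤ h → h ≤ i → i ≤ k → k ≤ n → T h k = 0) : tripTollAt n T i = 0 := by
  refine Finset.sum_eq_zero fun a ha => Finset.sum_eq_zero fun k hk => ?_
  simp only [Finset.mem_Icc] at ha hk
  exact h a k ha.1 ha.2 hk.1 hk.2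

lemma sps_iness (n : ℕ) : InessentialSegment n (SPS n) := by
  intro T hT i hi h
  obtain ⟨h1, h2⟩ := Finset.mem_Icc.1 hi
  simp [SPS, trip_zero h, h i i h1 le_rfl le_rfl h2]

lemma sps_wss (n : ℕ) : WeightedSegmentSymmetric n (SPS n) := by
  intro T hT hd i hi j hj _ _
  simp only [Finset.mem_Icc] at hi hj
  unfold SPS
  rw [hd i hi.1 hi.2, hd j hj.1 hj.2]
  split_ifs
  · ring
  · ring

lemma sps_cov (n : ℕ) : CovariantMethod n (SPS n) := by
  intro T T' hT hT' b hb a h1 h2 i hi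
  have hD : Dsep n T' = b * Dsep n T := by
    unfold Dsep
    rw [Finset.mul_sum]
    refine Finset.sum_congr rfl fun j hj => ?_
    rw [trip_cov h1 h2 hj, h2 j (Finset.mem_Icc.1 hj).1 (Finset.mem_Icc.1 hj).2]
    ring
  have hii := h2 i (Finset.mem_Icc.1 hi).1 (Finset.mem_Icc.1 hi).2
  unfold SPS
  rw [hD, total_cov h1 h2, trip_cov h1 h2 hi, hii]
  rcases hb.eq_or_lt with rfl | hb
  · simp
  · by_cases hp : 0 < Dsep n T
    · rw [if_pos hp, if_pos (mul_pos hb hp)]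
      field_simp
      ring
    · rw [if_neg hp, if_neg (by rwa [mul_pos_iff_of_pos_left hb])]

lemma iness_of_not {n : ℕ} {T : ℕ → ℕ → ℝ} (hT : IsTollMatrix n T) {i : ℕ}
    (h : ¬ Essential n T i) : ∀ h k, 1 ≤ h → h ≤ i → i ≤ k → k ≤ n → T h k = 0 := by
  intro a k h1 h2 h3 h4
  by_contra hne
  exact h ⟨a, k, h1, h2, h3, h4, lt_of_le_of_ne (hT.1 a k) (Ne.symm hne)⟩

lemma trip_pos {n : ℕ} {T : ℕ → ℕ → ℝ} (hT : IsTollMatrix n T) {i : ℕ}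
    (h : Essential n T i) : 0 < tripTollAt n T i := by
  obtain ⟨a, k, h1, h2, h3, h4, h5⟩ := h
  have e1 := Finset.single_le_sum (f := fun h => ∑ k ∈ Finset.Icc i n, T h k)
    (fun h _ => Finset.sum_nonneg fun k _ => hT.1 h k) (Finset.mem_Icc.2 ⟨h1, h2⟩)
  have e2 := Finset.single_le_sum (f := fun k => T a k) (fun k _ => hT.1 a k)
    (Finset.mem_Icc.2 ⟨h3, h4⟩)
  unfold tripTollAt
  exact lt_of_lt_of_le h5 (e2.trans e1)

lemma f_mul {n : ℕ} {f : (ℕ → ℕ → ℝ) → ℕ → ℝ} (he : Efficient n f)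
    (hi : InessentialSegment n f) (hw : WeightedSegmentSymmetric n f)
    {T : ℕ → ℕ → ℝ} (hT : IsTollMatrix n T) (hd : ∀ i, 1 ≤ i → i ≤ n → T i i = 0)
    {i : ℕ} (hin : i ∈ Finset.Icc 1 n) (hes : Essential n T i) :
    f T i * ∑ j ∈ Finset.Icc 1 n, tripTollAt n T j =
      (∑ h ∈ Finset.Icc 1 n, ∑ k ∈ Finset.Icc h n, T h k) * tripTollAt n T i := by
  rw [← he T hT, Finset.mul_sum, Finset.sum_mul]
  refine Finset.sum_congr rfl fun j hj => ?_
  by_cases hj' : Essential n T j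
  · exact hw T hT hd i hin j hj hes hj'
  · have := iness_of_not hT hj'
    rw [trip_zero this, hi T hT j hj this]; ring

lemma f_unique_diag {n : ℕ} {f g : (ℕ → ℕ → ℝ) → ℕ → ℝ} (he : Efficient n f)
    (hi : InessentialSegment n f) (hw : WeightedSegmentSymmetric n f)
    (he' : Efficient n g)
    (hi' : InessentialSegment n g) (hw' : WeightedSegmentSymmetric n g)
    {T : ℕ → ℕ → ℝ} (hT : IsTollMatrix n T) (hd : ∀ i, 1 ≤ i → i ≤ n → T i i = 0)
    {i : ℕ} (hin : i ∈ Finset.Icc 1 n) : f T i = g T i := by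
  by_cases hes : Essential n T i
  · have hpos : 0 < ∑ j ∈ Finset.Icc 1 n, tripTollAt n T j :=
      lt_of_lt_of_le (trip_pos hT hes) (Finset.single_le_sum (f := fun j => tripTollAt n T j)
        (fun j _ => Finset.sum_nonneg fun h _ => Finset.sum_nonneg fun k _ => hT.1 h k) hin)
    apply mul_right_cancel₀ hpos.ne'
    rw [f_mul he hi hw hT hd hin hes, f_mul he' hi' hw' hT hd hin hes]
  · have := iness_of_not hT hes
    rw [hi T hT i hin this, hi' T hT i hin this]

/-- The SPS method satisfies efficiency, the inessential segment property,
weighted segment symmetry and covariance, and it is the unique toll allocation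
method satisfying these four properties. -/
theorem SPS_characterization (n : ℕ) (hn : 1 ≤ n) :
    (Efficient n (SPS n) ∧ InessentialSegment n (SPS n) ∧
      WeightedSegmentSymmetric n (SPS n) ∧ CovariantMethod n (SPS n)) ∧
    ∀ f, IsMethod n f → Efficient n f → InessentialSegment n f →
      WeightedSegmentSymmetric n f → CovariantMethod n f →
      ∀ T, IsTollMatrix n T → ∀ i ∈ Finset.Icc 1 n, f T i = SPS n T i := by
  refine ⟨⟨sps_eff n, sps_iness n, sps_wss n, sps_cov n⟩, ?_⟩
  intro f _ he hi hw hc T hT i hin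
  have hT0 : IsTollMatrix n (fun h k => if h = k then 0 else T h k) := by
    refine ⟨fun h k => ?_, fun h k hk => ?_, fun h k hk => ?_⟩
    · dsimp only
      split_ifs
      exacts [le_rfl, hT.1 h k]
    · simp [hT.2.1 h k hk]
    · simp [hT.2.2 h k hk]
  have key := f_unique_diag he hi hw (sps_eff n) (sps_iness n) (sps_wss n) hT0
    (fun i _ _ => by simp) hin
  have c : ∀ g, CovariantMethod n g →
      g T i = 1 * g (fun h k => if h = k then 0 else T h k) i + T i i := fun g hg =>
    hg _ T hT0 hT 1 zero_le_one (fun i => T i i)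
      (fun i j _ _ _ _ hne => by simp [hne]) (fun i _ _ => by simp) i hin
  rw [c f hc, c _ (sps_cov n), key]
end

section
/- For every n ≥ 1 and every toll matrix T, the Segments Proportional Sharing allocation is the τ-value of the segments allocation game: there exists α ∈ ℝ such that f^{Sp}_i(N,T) = m_i(N,v^{Se}) + α·(M_i(N,v^{Se}) − m_i(N,v^{Se})) for all i ∈ N, and moreover Σ_{i∈N} f^{Sp}_i(N,T) = v^{Se}(N). -/
open Finset

/-- The utopia vector `M_i(N,v) = v(N) − v(N∖{i})`. -/
def utopia (n : ℕ) (v : Finset ℕ → ℝ) (i : ℕ) : ℝ :=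
  v (Finset.Icc 1 n) - v ((Finset.Icc 1 n).erase i)

/-- The minimal rights vector
`m_i(N,v) = max_{S ∋ i} (v(S) − Σ_{j ∈ S∖{i}} M_j(N,v))`. -/
noncomputable def minRight (n : ℕ) (v : Finset ℕ → ℝ) (i : ℕ) : ℝ :=
  sSup {x : ℝ | ∃ S ⊆ Finset.Icc 1 n, i ∈ S ∧
    x = v S - ∑ j ∈ S.erase i, utopia n v j}

lemma aux_trip (n : ℕ) (T : ℕ → ℕ → ℝ) (i : ℕ) (hi : i ∈ Finset.Icc 1 n) :
    tripTollAt n T i = ∑ h ∈ Finset.Icc 1 n, ∑ k ∈ Finset.Icc h n,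
      if i ∈ Finset.Icc h k then T h k else 0 := by
  have hi' := Finset.mem_Icc.1 hi
  unfold tripTollAt
  have h1 : Finset.Icc 1 i = (Finset.Icc 1 n).filter (fun h => h ≤ i) := by
    ext x; simp only [Finset.mem_Icc, Finset.mem_filter]; omega
  rw [h1, Finset.sum_filter]
  refine Finset.sum_congr rfl fun h hh => ?_
  rw [← Finset.sum_filter]
  split_ifs with hle
  · refine Finset.sum_congr ?_ fun _ _ => rfl
    ext x; simp only [Finset.mem_Icc, Finset.mem_filter]; omega
  · symm
    rw [Finset.sum_eq_zero]
    intro x hx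
    simp only [Finset.mem_Icc, Finset.mem_filter] at hx
    omega

lemma aux_total (n : ℕ) (T : ℕ → ℕ → ℝ) :
    vSe n T (Finset.Icc 1 n) = ∑ h ∈ Finset.Icc 1 n, ∑ k ∈ Finset.Icc h n, T h k := by
  unfold vSe
  refine Finset.sum_congr rfl fun h hh => Finset.sum_congr rfl fun k hk => ?_
  rw [Finset.mem_Icc] at hh hk
  rw [if_pos (Finset.Icc_subset_Icc hh.1 hk.2)]

lemma aux_utopia (n : ℕ) (T : ℕ → ℕ → ℝ) (i : ℕ) (hi : i ∈ Finset.Icc 1 n) :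
    utopia n (vSe n T) i = tripTollAt n T i := by
  rw [aux_trip n T i hi, utopia, aux_total, vSe, ← Finset.sum_sub_distrib]
  refine Finset.sum_congr rfl fun h hh => ?_
  rw [← Finset.sum_sub_distrib]
  refine Finset.sum_congr rfl fun k hk => ?_
  rw [Finset.mem_Icc] at hh hk
  have hs := Finset.Icc_subset_Icc hh.1 hk.2
  by_cases hm : i ∈ Finset.Icc h k
  · rw [if_pos hm, if_neg]
    · ring
    · intro hc
      exact absurd (hc hm) (by simp)
  · rw [if_neg hm, if_pos]
    · ring
    · intro x hx
      refine Finset.mem_erase.2 ⟨?_, hs hx⟩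
      rintro rfl
      exact hm hx

lemma aux_bound (n : ℕ) (T : ℕ → ℕ → ℝ) (hT : ∀ h k, 0 ≤ T h k) (i : ℕ)
    (hi : i ∈ Finset.Icc 1 n) (S : Finset ℕ) (hS : S ⊆ Finset.Icc 1 n) :
    vSe n T S ≤ T i i + ∑ j ∈ S.erase i, tripTollAt n T j := by
  have e1 : T i i = ∑ h ∈ Finset.Icc 1 n, ∑ k ∈ Finset.Icc h n,
      if h = i ∧ k = i then T h k else 0 := by
    rw [Finset.sum_eq_single_of_mem i hi, Finset.sum_eq_single_of_mem i]
    · simp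
    · simpa using (Finset.mem_Icc.1 hi).2
    · intro b _ hb; simp [hb]
    · intro b _ hb; simp [hb]
  have e2 : ∑ j ∈ S.erase i, tripTollAt n T j = ∑ h ∈ Finset.Icc 1 n, ∑ k ∈ Finset.Icc h n,
      ∑ j ∈ S.erase i, if j ∈ Finset.Icc h k then T h k else 0 := by
    rw [Finset.sum_congr rfl fun j hj => aux_trip n T j (hS (Finset.mem_of_mem_erase hj)),
      Finset.sum_comm]
    exact Finset.sum_congr rfl fun h _ => Finset.sum_comm
  rw [e1, e2, ← Finset.sum_add_distrib, vSe]
  refine Finset.sum_le_sum fun h hh => ?_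
  rw [← Finset.sum_add_distrib]
  refine Finset.sum_le_sum fun k hk => ?_
  rw [Finset.mem_Icc] at hh hk
  have n1 : 0 ≤ (if h = i ∧ k = i then T h k else 0) := by
    split_ifs
    · exact hT _ _
    · exact le_rfl
  have n3 : ∀ j ∈ S.erase i, 0 ≤ (if j ∈ Finset.Icc h k then T h k else 0) := by
    intro j _
    split_ifs
    · exact hT _ _
    · exact le_rfl
  have n2 := Finset.sum_nonneg n3
  by_cases hc : Finset.Icc h k ⊆ S
  · rw [if_pos hc]
    by_cases he : h = i ∧ k = i
    · rw [if_pos he]; linarith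
    · have : ∃ j, j ≠ i ∧ j ∈ Finset.Icc h k := by
        by_cases hhi : h = i
        · exact ⟨k, fun hk' => he ⟨hhi, hk'⟩, Finset.mem_Icc.2 ⟨hk.1, le_rfl⟩⟩
        · exact ⟨h, hhi, Finset.mem_Icc.2 ⟨le_rfl, hk.1⟩⟩
      obtain ⟨j, hji, hj⟩ := this
      have := Finset.single_le_sum n3 (Finset.mem_erase.2 ⟨hji, hc hj⟩)
      rw [if_pos hj] at this
      linarith
  · rw [if_neg hc]; linarith

lemma aux_diag_le (n : ℕ) (T : ℕ → ℕ → ℝ) (hT : ∀ h k, 0 ≤ T h k) (S : Finset ℕ)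
    (hS : S ⊆ Finset.Icc 1 n) : ∑ i ∈ S, T i i ≤ vSe n T S := by
  have n0 : ∀ h k, 0 ≤ (if Finset.Icc h k ⊆ S then T h k else 0) := by
    intro h k
    split_ifs
    · exact hT _ _
    · exact le_rfl
  unfold vSe
  refine le_trans ?_ (Finset.sum_le_sum_of_subset_of_nonneg hS
    fun h _ _ => Finset.sum_nonneg fun k _ => n0 h k)
  refine Finset.sum_le_sum fun i hi => ?_
  have h2 := Finset.single_le_sum (f := fun k => if Finset.Icc i k ⊆ S then T i k else 0)
    (fun k _ => n0 i k) (Finset.mem_Icc.2 ⟨le_rfl, (Finset.mem_Icc.1 (hS hi)).2⟩)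
  simpa [hi] using h2

lemma aux_trip_ge (n : ℕ) (T : ℕ → ℕ → ℝ) (hT : ∀ h k, 0 ≤ T h k) (i : ℕ)
    (hi : i ∈ Finset.Icc 1 n) : T i i ≤ tripTollAt n T i := by
  have hi' := Finset.mem_Icc.1 hi
  unfold tripTollAt
  refine le_trans ?_ (Finset.single_le_sum (f := fun h => ∑ k ∈ Finset.Icc i n, T h k)
    (fun h _ => Finset.sum_nonneg fun k _ => hT h k) (Finset.mem_Icc.2 ⟨hi'.1, le_rfl⟩))
  exact Finset.single_le_sum (f := fun k => T i k) (fun k _ => hT i k)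
    (Finset.mem_Icc.2 ⟨le_rfl, hi'.2⟩)

lemma aux_minRight (n : ℕ) (T : ℕ → ℕ → ℝ) (hT : ∀ h k, 0 ≤ T h k) (i : ℕ)
    (hi : i ∈ Finset.Icc 1 n) : minRight n (vSe n T) i = T i i := by
  have hs : ({i} : Finset ℕ) ⊆ Finset.Icc 1 n := by simpa using hi
  refine IsGreatest.csSup_eq ⟨⟨{i}, hs, by simp, ?_⟩, ?_⟩
  · have h1 := aux_bound n T hT i hi {i} hs
    have h2 := aux_diag_le n T hT {i} hs
    simp at h1 h2 ⊢
    linarith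
  · rintro x ⟨S, hS, hiS, rfl⟩
    have h1 := aux_bound n T hT i hi S hS
    rw [Finset.sum_congr rfl fun j hj => aux_utopia n T j (hS (Finset.mem_of_mem_erase hj))]
    linarith

/-- The SPS allocation is the τ-value of the segments allocation game. -/
theorem SPS_eq_tauValue (n : ℕ) (hn : 1 ≤ n) (T : ℕ → ℕ → ℝ)
    (hT : IsTollMatrix n T) :
    (∃ α : ℝ, ∀ i ∈ Finset.Icc 1 n,
      SPS n T i = minRight n (vSe n T) i +
        α * (utopia n (vSe n T) i - minRight n (vSe n T) i)) ∧
    ∑ i ∈ Finset.Icc 1 n, SPS n T i = vSe n T (Finset.Icc 1 n) := by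
  obtain ⟨h0, -, -⟩ := hT
  have hnn : ∀ j ∈ Finset.Icc 1 n, 0 ≤ tripTollAt n T j - T j j :=
    fun j hj => sub_nonneg.2 (aux_trip_ge n T h0 j hj)
  by_cases hD : 0 < Dsep n T
  · refine ⟨⟨((∑ h ∈ Finset.Icc 1 n, ∑ k ∈ Finset.Icc h n, T h k)
      - ∑ j ∈ Finset.Icc 1 n, T j j) / Dsep n T, fun i hi => ?_⟩, ?_⟩
    · rw [aux_minRight n T h0 i hi, aux_utopia n T i hi, SPS, if_pos hD]
      ring
    · simp only [SPS, if_pos hD]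
      rw [Finset.sum_add_distrib, ← Finset.sum_mul, ← Finset.sum_div, aux_total]
      rw [show ∑ j ∈ Finset.Icc 1 n, (tripTollAt n T j - T j j) = Dsep n T from rfl,
        div_self hD.ne']
      ring
  · refine ⟨⟨0, fun i hi => ?_⟩, ?_⟩
    · rw [aux_minRight n T h0 i hi, SPS, if_neg hD]
      ring
    · simp only [SPS, if_neg hD]
      have hz : Dsep n T = 0 := le_antisymm (not_lt.1 hD) (Finset.sum_nonneg hnn)
      have hz' := (Finset.sum_eq_zero_iff_of_nonneg hnn).1 hz
      have h1 : 1 ∈ Finset.Icc 1 n := Finset.mem_Icc.2 ⟨le_rfl, hn⟩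
      refine le_antisymm (aux_diag_le n T h0 _ subset_rfl) ?_
      refine (aux_bound n T h0 1 h1 _ subset_rfl).trans ?_
      rw [Finset.sum_congr rfl fun j hj => sub_eq_zero.1 (hz' j (Finset.mem_of_mem_erase hj)),
        Finset.add_sum_erase _ (fun j => T j j) h1]
end

section
/- For every n ≥ 1, the Segments Compensated Sharing method f^{Sc} satisfies efficiency, linearity, the inessential segment property, weak segment symmetry, and indifference to individual extensions; and it is the unique toll allocation method satisfying these five properties, i.e. any toll allocation method f satisfying all five satisfies f(N,T) = f^{Sc}(N,T) for every toll matrix T. -/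
open Finset

/-- The Segments Compensated Sharing (SCS) method. -/
noncomputable def SCS (n : ℕ) (T : ℕ → ℕ → ℝ) (i : ℕ) : ℝ :=
  (1 / (n : ℝ)) *
    (((i : ℝ) - 1) * (∑ k ∈ Finset.Icc i n, T i k) +
      (∑ h ∈ Finset.Icc 1 i, ∑ k ∈ Finset.Icc i n, T h k) +
      ((n : ℝ) - (i : ℝ)) * (∑ h ∈ Finset.Icc 1 i, T h i))
/-- Linearity. -/
def LinearMethod (n : ℕ) (f : (ℕ → ℕ → ℝ) → ℕ → ℝ) : Prop :=
  ∀ T T', IsTollMatrix n T → IsTollMatrix n T' → ∀ b b' : ℝ, 0 ≤ b → 0 ≤ b' →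
    ∀ i ∈ Finset.Icc 1 n,
      f (fun h k => b * T h k + b' * T' h k) i = b * f T i + b' * f T' i
/-- Weak segment symmetry: if only the full trip `[1,n]` may carry a toll,
then all segments receive the same share. -/
def WeakSegmentSymmetric (n : ℕ) (f : (ℕ → ℕ → ℝ) → ℕ → ℝ) : Prop :=
  ∀ T, IsTollMatrix n T →
    (∀ h k, 1 ≤ h → h ≤ k → k ≤ n → ¬(h = 1 ∧ k = n) → T h k = 0) →
    ∀ i ∈ Finset.Icc 1 n, ∀ j ∈ Finset.Icc 1 n, f T i = f T j

/-- The unitary toll matrix `δ^{hk}`. -/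
noncomputable def unitToll (h k : ℕ) : ℕ → ℕ → ℝ :=
  fun i j => if i = h ∧ j = k then 1 else 0

/-- Indifference to individual extensions. -/
def IndiffToIndivExtensions (n : ℕ) (f : (ℕ → ℕ → ℝ) → ℕ → ℝ) : Prop :=
  ∀ h k, 1 ≤ h → h ≤ k → k ≤ n →
    (2 ≤ h → ∀ i ∈ Finset.Icc h k, i ≠ h →
      f (unitToll (h - 1) k) i = f (unitToll h k) i) ∧
    (k + 1 ≤ n → ∀ i ∈ Finset.Icc h k, i ≠ k →
      f (unitToll h (k + 1)) i = f (unitToll h k) i)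

lemma isToll_unit {n h k : ℕ} (h1 : 1 ≤ h) (hk : h ≤ k) (kn : k ≤ n) :
    IsTollMatrix n (unitToll h k) := by
  refine ⟨fun a b => ?_, fun a b hab => ?_, fun a b hab => ?_⟩
  · unfold unitToll; split_ifs <;> norm_num
  · unfold unitToll; rw [if_neg]; omega
  · unfold unitToll; rw [if_neg]; omega

lemma SCS_linear (n : ℕ) : LinearMethod n (SCS n) := by
  intro T T' _ _ b b' _ _ i _
  simp only [SCS, Finset.sum_add_distrib, ← Finset.mul_sum]
  ring

lemma SCS_unit {n h k i : ℕ} (h1 : 1 ≤ h) (hk : h ≤ k) (kn : k ≤ n) :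
    SCS n (unitToll h k) i = if h ≤ i ∧ i ≤ k then
      (1 / (n : ℝ)) * ((if i = h then (h : ℝ) - 1 else 0) + 1 +
        (if i = k then (n : ℝ) - k else 0)) else 0 := by
  have e1 : ∑ b ∈ Finset.Icc i n, unitToll h k i b = if i = h then 1 else 0 := by
    by_cases hi : i = h
    · subst hi
      simp [unitToll, hk, kn]
    · simp [unitToll, hi]
  have e3 : ∑ a ∈ Finset.Icc 1 i, unitToll h k a i = if i = k then 1 else 0 := by
    by_cases hi : i = k
    · subst hi
      simp [unitToll, hk, h1]
    · simp [unitToll, hi]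
  have e2 : ∑ a ∈ Finset.Icc 1 i, ∑ b ∈ Finset.Icc i n, unitToll h k a b
      = if h ≤ i ∧ i ≤ k then 1 else 0 := by
    simp only [unitToll, ite_and, Finset.sum_ite_irrel, Finset.sum_ite_eq', Finset.sum_const_zero,
      Finset.mem_Icc, h1, kn, true_and, and_true]
  unfold SCS
  rw [e1, e2, e3]
  split_ifs <;> first | omega | (subst_vars; ring)

lemma linear_decomp {n : ℕ} {f : (ℕ → ℕ → ℝ) → ℕ → ℝ} (hf : LinearMethod n f)
    {T : ℕ → ℕ → ℝ} (hT : IsTollMatrix n T) {i : ℕ} (hi : i ∈ Finset.Icc 1 n) :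
    f T i = ∑ h ∈ Finset.Icc 1 n, ∑ k ∈ Finset.Icc h n, T h k * f (unitToll h k) i := by
  have key : ∀ S : Finset (Σ _ : ℕ, ℕ), S ⊆ (Finset.Icc 1 n).sigma (fun h => Finset.Icc h n) →
      IsTollMatrix n (fun a b => ∑ p ∈ S, T p.1 p.2 * unitToll p.1 p.2 a b) ∧
      f (fun a b => ∑ p ∈ S, T p.1 p.2 * unitToll p.1 p.2 a b) i
        = ∑ p ∈ S, T p.1 p.2 * f (unitToll p.1 p.2) i := by
    intro S
    induction S using Finset.induction_on with
    | empty =>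
      intro _
      have hz : IsTollMatrix n (fun _ _ => 0) :=
        ⟨fun _ _ => le_refl _, fun _ _ _ => rfl, fun _ _ _ => rfl⟩
      refine ⟨by simpa using hz, ?_⟩
      have := hf _ _ hz hz 0 0 le_rfl le_rfl i hi
      simpa using this
    | insert p S hp ih =>
      intro hS
      obtain ⟨i1, i2⟩ := ih (fun x hx => hS (Finset.mem_insert_of_mem hx))
      have hpm := hS (Finset.mem_insert_self p S)
      simp only [Finset.mem_sigma, Finset.mem_Icc] at hpm
      have hu := isToll_unit hpm.1.1 hpm.2.1 hpm.2.2
      have hl := hf _ _ hu i1 (T p.1 p.2) 1 (hT.1 _ _) zero_le_one i hi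
      simp only [Finset.sum_insert hp]
      simp only [one_mul] at hl
      refine ⟨⟨fun a b => ?_, fun a b hab => ?_, fun a b hab => ?_⟩, ?_⟩
      · exact add_nonneg (mul_nonneg (hT.1 _ _) (hu.1 _ _)) (i1.1 a b)
      · have := i1.2.1 a b hab
        simp only at this ⊢
        rw [this, hu.2.1 a b hab]; simp
      · have := i1.2.2 a b hab
        simp only at this ⊢
        rw [this, hu.2.2 a b hab]; simp
      · rw [hl, i2]
  have h2 := (key _ (Finset.Subset.refl _)).2
  have hTe : (fun a b => ∑ p ∈ (Finset.Icc 1 n).sigma (fun h => Finset.Icc h n),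
      T p.1 p.2 * unitToll p.1 p.2 a b) = T := by
    funext a b
    by_cases hab : 1 ≤ a ∧ a ≤ b ∧ b ≤ n
    · rw [Finset.sum_eq_single (⟨a, b⟩ : Σ _ : ℕ, ℕ)]
      · simp [unitToll]
      · rintro ⟨c, d⟩ _ hne
        have : ¬ (a = c ∧ b = d) := by
          rintro ⟨rfl, rfl⟩; exact hne rfl
        simp [unitToll, this]
      · intro hn
        exfalso; apply hn
        simp only [Finset.mem_sigma, Finset.mem_Icc]; omega
    · have hz : T a b = 0 := by
        by_cases hba : b < a
        · exact hT.2.1 a b hba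
        · exact hT.2.2 a b (by omega)
      rw [hz]
      apply Finset.sum_eq_zero
      rintro ⟨c, d⟩ hcd
      simp only [Finset.mem_sigma, Finset.mem_Icc] at hcd
      simp only [unitToll]
      rw [if_neg (by omega), mul_zero]
  rw [hTe, Finset.sum_sigma] at h2
  exact h2

lemma SCS_unit_sum {n h k : ℕ} (h1 : 1 ≤ h) (hk : h ≤ k) (kn : k ≤ n) :
    ∑ i ∈ Finset.Icc 1 n, SCS n (unitToll h k) i = 1 := by
  have hn : (n : ℝ) ≠ 0 := by
    have : n ≠ 0 := by omega
    exact_mod_cast this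
  simp only [SCS_unit h1 hk kn]
  rw [← Finset.sum_filter]
  have : (Finset.Icc 1 n).filter (fun i => h ≤ i ∧ i ≤ k) = Finset.Icc h k := by
    ext i; simp only [Finset.mem_filter, Finset.mem_Icc]; omega
  rw [this, ← Finset.mul_sum, Finset.sum_add_distrib, Finset.sum_add_distrib]
  simp only [Finset.sum_ite_eq', Finset.mem_Icc, le_refl, hk, and_self, if_true,
    Finset.sum_const, Nat.card_Icc, nsmul_eq_mul, mul_one]
  rw [Nat.cast_sub (by omega)]
  push_cast
  field_simp
  ring

lemma total_unit {n h k : ℕ} (h1 : 1 ≤ h) (hk : h ≤ k) (kn : k ≤ n) :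
    ∑ a ∈ Finset.Icc 1 n, ∑ b ∈ Finset.Icc a n, unitToll h k a b = 1 := by
  rw [Finset.sum_eq_single h]
  · simp [unitToll, hk, kn]
  · intro b _ hb; simp [unitToll, hb]
  · intro hn; exfalso; apply hn; simp only [Finset.mem_Icc]; omega

lemma unit_unique {n : ℕ} {f : (ℕ → ℕ → ℝ) → ℕ → ℝ} (hE : Efficient n f)
    (hI : InessentialSegment n f) (hW : WeakSegmentSymmetric n f)
    (hX : IndiffToIndivExtensions n f) {h k : ℕ} (h1 : 1 ≤ h) (hk : h ≤ k) (kn : k ≤ n)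
    {i : ℕ} (hi : i ∈ Finset.Icc 1 n) :
    f (unitToll h k) i = SCS n (unitToll h k) i := by
  have hn : (n : ℝ) ≠ 0 := by
    have : n ≠ 0 := by omega
    exact_mod_cast this
  have out : ∀ h k i, 1 ≤ h → h ≤ k → k ≤ n → i ∈ Finset.Icc 1 n → ¬ (h ≤ i ∧ i ≤ k) →
      f (unitToll h k) i = 0 := by
    intro h k i h1 hk kn hi hne
    apply hI _ (isToll_unit h1 hk kn) i hi
    intro a b _ _ _ _
    unfold unitToll; rw [if_neg]; omega
  have sum1 : ∀ h k, 1 ≤ h → h ≤ k → k ≤ n → ∑ i ∈ Finset.Icc h k, f (unitToll h k) i = 1 := by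
    intro h k h1 hk kn
    rw [← total_unit h1 hk kn, ← hE _ (isToll_unit h1 hk kn)]
    apply Finset.sum_subset
    · exact Finset.Icc_subset_Icc h1 kn
    · intro i hi hni
      exact out h k i h1 hk kn hi (by simpa using hni)
  have right : ∀ h k, 1 ≤ h → h ≤ k → ∀ m, k ≤ m → m ≤ n → ∀ i, h ≤ i → i < k →
      f (unitToll h m) i = f (unitToll h k) i := by
    intro h k h1 hk m hm
    induction m, hm using Nat.le_induction with
    | base => intros; rfl
    | succ m hm ih =>
      intro hmn i hi1 hi2
      rw [← ih (by omega) i hi1 hi2]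
      exact (hX h m h1 (by omega) (by omega)).2 hmn i (by simp only [Finset.mem_Icc]; omega)
        (by omega)
  have left : ∀ k, k ≤ n → ∀ h, 1 ≤ h → h ≤ k → ∀ i, h < i → i ≤ k →
      f (unitToll h k) i = f (unitToll 1 k) i := by
    intro k kn h h1
    induction h, h1 using Nat.le_induction with
    | base => intros; rfl
    | succ m hm ih =>
      intro hmn i hi1 hi2
      rw [← ih (by omega) i (by omega) hi2]
      exact ((hX (m + 1) k (by omega) (by omega) kn).1 (by omega) i
        (by simp only [Finset.mem_Icc]; omega) (by omega)).symm
  have full : ∀ i, 1 ≤ i → i ≤ n → f (unitToll 1 n) i = 1 / n := by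
    intro i hi1 hi2
    have hs := sum1 1 n le_rfl (by omega) le_rfl
    have hc : ∀ j ∈ Finset.Icc 1 n, f (unitToll 1 n) j = f (unitToll 1 n) i := by
      intro j hj
      refine hW _ (isToll_unit le_rfl (by omega) le_rfl) ?_ j hj i (by simp; omega)
      intro a b _ _ _ hab
      simp [unitToll, hab]
    rw [Finset.sum_congr rfl hc] at hs
    simp at hs
    field_simp
    linarith
  have start : ∀ h, 1 ≤ h → h < n → f (unitToll h n) h = h / n := by
    intro h h1 hh
    have hs := sum1 h n h1 hh.le le_rfl
    rw [← Finset.add_sum_Ioc_eq_sum_Icc hh.le, Finset.sum_congr rfl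
      (g := fun _ => 1 / (n : ℝ))] at hs
    · simp [Nat.cast_sub hh.le] at hs
      field_simp at hs ⊢
      linarith
    · intro i hi
      simp only [Finset.mem_Ioc] at hi
      rw [left n le_rfl h h1 hh.le i hi.1 hi.2, full i (by omega) hi.2]
  have fin_seg : ∀ k, 1 < k → k ≤ n → f (unitToll 1 k) k = (n - k + 1) / n := by
    intro k h1 hh
    have hs := sum1 1 k le_rfl h1.le hh
    rw [← Finset.sum_Ico_add_eq_sum_Icc h1.le, Finset.sum_congr rfl
      (g := fun _ => 1 / (n : ℝ))] at hs
    · simp [Nat.cast_sub h1.le] at hs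
      field_simp at hs ⊢
      linarith
    · intro i hi
      simp only [Finset.mem_Ico] at hi
      rw [← right 1 k le_rfl h1.le n hh le_rfl i hi.1 hi.2, full i (by omega) (by omega)]
  rw [SCS_unit h1 hk kn]
  by_cases hin : h ≤ i ∧ i ≤ k
  · rw [if_pos hin]
    obtain ⟨hi1, hi2⟩ := hin
    rcases hi1.eq_or_lt with rfl | hlt
    · rcases hi2.eq_or_lt with rfl | hlt2
      · have := sum1 h h h1 le_rfl kn
        simp only [Finset.Icc_self, Finset.sum_singleton] at this
        rw [this]; simp only [if_true]; field_simp; ring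
      · rw [← right h k h1 hk n kn le_rfl h le_rfl hlt2, start h h1 (by omega), if_pos rfl,
          if_neg hlt2.ne]
        ring
    · rcases hi2.eq_or_lt with rfl | hlt2
      · rw [left i kn h h1 hk i hlt le_rfl, fin_seg i (by omega) kn, if_neg hlt.ne', if_pos rfl]
        ring
      · rw [← right h k h1 hk n kn le_rfl i hi1 hlt2, left n le_rfl h h1 (by omega) i hlt (by omega),
          full i (by omega) (by omega), if_neg hlt.ne', if_neg hlt2.ne]
        ring
  · rw [if_neg hin]
    exact out h k i h1 hk kn hi hin

/-- The SCS method satisfies efficiency, linearity, the inessential segment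
property, weak segment symmetry and indifference to individual extensions,
and it is the unique toll allocation method satisfying these five
properties. -/
theorem SCS_characterization_one (n : ℕ) (hn : 1 ≤ n) :
    (Efficient n (SCS n) ∧ LinearMethod n (SCS n) ∧ InessentialSegment n (SCS n) ∧
      WeakSegmentSymmetric n (SCS n) ∧ IndiffToIndivExtensions n (SCS n)) ∧
    ∀ f, IsMethod n f → Efficient n f → LinearMethod n f → InessentialSegment n f →
      WeakSegmentSymmetric n f → IndiffToIndivExtensions n f →
      ∀ T, IsTollMatrix n T → ∀ i ∈ Finset.Icc 1 n, f T i = SCS n T i := by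
  have hlin := SCS_linear n
  refine ⟨⟨?_, hlin, ?_, ?_, ?_⟩, ?_⟩
  · intro T hT
    rw [Finset.sum_congr rfl (fun i hi => linear_decomp hlin hT hi), Finset.sum_comm]
    apply Finset.sum_congr rfl
    intro h hh
    rw [Finset.sum_comm]
    apply Finset.sum_congr rfl
    intro k hk
    simp only [Finset.mem_Icc] at hh hk
    rw [← Finset.mul_sum, SCS_unit_sum hh.1 hk.1 hk.2, mul_one]
  · intro T hT i hi hz
    rw [linear_decomp hlin hT hi]
    apply Finset.sum_eq_zero
    intro h hh
    apply Finset.sum_eq_zero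
    intro k hk
    simp only [Finset.mem_Icc] at hh hk
    by_cases hin : h ≤ i ∧ i ≤ k
    · rw [hz h k hh.1 hin.1 hin.2 hk.2, zero_mul]
    · rw [SCS_unit hh.1 hk.1 hk.2, if_neg hin, mul_zero]
  · intro T hT hz i hi j hj
    rw [linear_decomp hlin hT hi, linear_decomp hlin hT hj]
    apply Finset.sum_congr rfl
    intro h hh
    apply Finset.sum_congr rfl
    intro k hk
    simp only [Finset.mem_Icc] at hh hk hi hj
    by_cases he : h = 1 ∧ k = n
    · obtain ⟨rfl, rfl⟩ := he
      rw [SCS_unit hh.1 hk.1 hk.2, SCS_unit hh.1 hk.1 hk.2, if_pos hi, if_pos hj]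
      simp
    · rw [hz h k hh.1 hk.1 hk.2 he, zero_mul, zero_mul]
  · intro h k h1 hk kn
    refine ⟨fun h2 i hi hne => ?_, fun h2 i hi hne => ?_⟩
    · simp only [Finset.mem_Icc] at hi
      rw [SCS_unit (by omega) (by omega) kn, SCS_unit h1 hk kn, if_pos (by omega), if_pos hi,
        if_neg hne, if_neg (show ¬ i = h - 1 by omega)]
    · simp only [Finset.mem_Icc] at hi
      rw [SCS_unit h1 (by omega) h2, SCS_unit h1 hk kn, if_pos (by omega), if_pos hi,
        if_neg hne, if_neg (show ¬ i = k + 1 by omega)]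
  · intro f _ hE hL hI hW hX T hT i hi
    rw [linear_decomp hL hT hi, linear_decomp hlin hT hi]
    apply Finset.sum_congr rfl
    intro h hh
    apply Finset.sum_congr rfl
    intro k hk
    simp only [Finset.mem_Icc] at hh hk
    rw [unit_unique hE hI hW hX hh.1 hk.1 hk.2 hi]
end

section
/- For every n ≥ 1, the Segments Compensated Sharing method f^{Sc} satisfies toll component fairness and sub-highway efficiency, and it is the unique toll allocation method satisfying these two properties. -/
open Finset

/-- Toll component fairness. -/
def TollComponentFairness (n : ℕ) (f : (ℕ → ℕ → ℝ) → ℕ → ℝ) : Prop :=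
  ∀ T T', IsTollMatrix n T → IsTollMatrix n T' → ∀ i, 1 ≤ i → i < n →
    (∀ h k, 1 ≤ h → h ≤ k → k ≤ n →
      ((k ≤ i ∨ i + 1 ≤ h) → T' h k = T h k) ∧ (h ≤ i → i < k → T' h k = 0)) →
    (1 / (i : ℝ)) * ∑ h ∈ Finset.Icc 1 i, (f T h - f T' h) =
      (1 / ((n : ℝ) - (i : ℝ))) * ∑ k ∈ Finset.Icc (i + 1) n, (f T k - f T' k)
noncomputable def wgt (n h k j : ℕ) : ℝ :=
  (1 / (n : ℝ)) * (((j : ℝ) - 1) * (if h = j ∧ j ≤ k then 1 else 0) +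
    (if h ≤ j ∧ j ≤ k then 1 else 0) + ((n : ℝ) - j) * (if h ≤ j ∧ k = j then 1 else 0))

noncomputable def cumw (n h k i : ℕ) : ℝ :=
  if k ≤ i then 1 else if h ≤ i then (i : ℝ) / n else 0

lemma cumw_eq (n h k : ℕ) (h1 : 1 ≤ h) (hk : h ≤ k) (kn : k ≤ n) (i : ℕ) :
    ∑ j ∈ Icc 1 i, wgt n h k j = cumw n h k i := by
  have hn : (n : ℝ) ≠ 0 := by
    have : n ≠ 0 := by omega
    exact_mod_cast this
  induction i with
  | zero => 
    have e1 : ¬ (k ≤ 0) := by omega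
    have e2 : ¬ (h ≤ 0) := by omega
    simp only [cumw, if_neg e1, if_neg e2]; simp
  | succ i ih =>
    rw [Finset.sum_Icc_succ_top (by omega), ih]
    unfold cumw wgt
    push_cast
    split_ifs <;> first | (exfalso; omega) | (field_simp; try ring)

lemma Icc_split (f : ℕ → ℝ) (a b : ℕ) (hab : a ≤ b) :
    ∑ j ∈ Icc (a + 1) b, f j = ∑ j ∈ Icc 1 b, f j - ∑ j ∈ Icc 1 a, f j := by
  induction b, hab using Nat.le_induction with
  | base => simp
  | succ b hb ih =>
    rw [Finset.sum_Icc_succ_top (by omega), Finset.sum_Icc_succ_top (by omega), ih]; ring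

lemma sum_up (n i j : ℕ) (hi : 1 ≤ i) (hj : j ≤ n) (g : ℕ → ℝ) :
    ∑ k ∈ Icc i j, g k = ∑ k ∈ Icc 1 n, if i ≤ k ∧ k ≤ j then g k else 0 := by
  rw [← Finset.sum_filter]
  congr 1
  ext x; simp only [mem_Icc, mem_filter]; omega

lemma SCS_eq (n : ℕ) (T : ℕ → ℕ → ℝ) (i : ℕ) (hi : 1 ≤ i) (hin : i ≤ n) :
    SCS n T i = ∑ h ∈ Icc 1 n, ∑ k ∈ Icc 1 n, T h k * wgt n h k i := by
  have A : ∑ k ∈ Icc i n, T i k =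
      ∑ h ∈ Icc 1 n, ∑ k ∈ Icc 1 n, T h k * (if h = i ∧ i ≤ k then 1 else 0) := by
    symm
    rw [Finset.sum_eq_single i, sum_up n i n hi le_rfl]
    · apply Finset.sum_congr rfl
      intro k hk
      have := (mem_Icc.1 hk).2
      simp [this]
    · intro b _ hb; simp [hb]
    · intro hh; exact absurd (mem_Icc.2 ⟨hi, hin⟩) hh
  have B : ∑ h ∈ Icc 1 i, ∑ k ∈ Icc i n, T h k =
      ∑ h ∈ Icc 1 n, ∑ k ∈ Icc 1 n, T h k * (if h ≤ i ∧ i ≤ k then 1 else 0) := by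
    rw [sum_up n 1 i le_rfl hin]
    apply Finset.sum_congr rfl
    intro h hh
    have h1 := (mem_Icc.1 hh).1
    rw [sum_up n i n hi le_rfl]
    by_cases hc : h ≤ i
    · simp only [h1, hc, and_self, if_true, true_and]
      apply Finset.sum_congr rfl
      intro k hk
      have := (mem_Icc.1 hk).2
      simp [this]
    · simp [hc]
  have C : ∑ h ∈ Icc 1 i, T h i =
      ∑ h ∈ Icc 1 n, ∑ k ∈ Icc 1 n, T h k * (if h ≤ i ∧ k = i then 1 else 0) := by
    rw [sum_up n 1 i le_rfl hin]
    apply Finset.sum_congr rfl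
    intro h hh
    have h1 := (mem_Icc.1 hh).1
    rw [Finset.sum_eq_single i]
    · simp [h1]
    · intro b _ hb; simp [hb]
    · intro hh; exact absurd (mem_Icc.2 ⟨hi, hin⟩) hh
  unfold SCS
  rw [A, B, C]
  simp only [Finset.mul_sum, ← Finset.sum_add_distrib]
  refine Finset.sum_congr rfl fun h _ => Finset.sum_congr rfl fun k _ => ?_
  unfold wgt; ring

lemma SCS_prefix (n : ℕ) (T : ℕ → ℕ → ℝ) (hT : IsTollMatrix n T) (i : ℕ) (hin : i ≤ n) :
    ∑ j ∈ Icc 1 i, SCS n T j = ∑ h ∈ Icc 1 n, ∑ k ∈ Icc 1 n, T h k * cumw n h k i := by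
  have : ∑ j ∈ Icc 1 i, SCS n T j =
      ∑ j ∈ Icc 1 i, ∑ h ∈ Icc 1 n, ∑ k ∈ Icc 1 n, T h k * wgt n h k j := by
    apply Finset.sum_congr rfl
    intro j hj
    rw [mem_Icc] at hj
    exact SCS_eq n T j hj.1 (by omega)
  rw [this, Finset.sum_comm]
  refine Finset.sum_congr rfl fun h hh => ?_
  rw [Finset.sum_comm]
  refine Finset.sum_congr rfl fun k hk => ?_
  rw [mem_Icc] at hh hk
  rw [← Finset.mul_sum]
  by_cases c : h ≤ k
  · rw [cumw_eq n h k hh.1 c hk.2]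
  · rw [hT.2.1 h k (by omega)]; simp

lemma SCS_fair (n : ℕ) : TollComponentFairness n (SCS n) := by
  intro T T' hT hT' i hi hin hyp
  have hi0 : (i : ℝ) ≠ 0 := by
    have : i ≠ 0 := by omega
    exact_mod_cast this
  have hn0 : (n : ℝ) ≠ 0 := by
    have : n ≠ 0 := by omega
    exact_mod_cast this
  have hni : (n : ℝ) - i ≠ 0 := by
    have : (i : ℝ) < n := by exact_mod_cast hin
    linarith
  rw [Icc_split _ i n hin.le]
  simp only [Finset.sum_sub_distrib]
  rw [SCS_prefix n T hT i hin.le, SCS_prefix n T' hT' i hin.le, SCS_prefix n T hT n le_rfl,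
    SCS_prefix n T' hT' n le_rfl]
  simp only [← Finset.sum_sub_distrib, Finset.mul_sum]
  refine Finset.sum_congr rfl fun h hh => Finset.sum_congr rfl fun k hk => ?_
  rw [mem_Icc] at hh hk
  by_cases c : h ≤ k
  · obtain ⟨p, q⟩ := hyp h k hh.1 c hk.2
    by_cases d : k ≤ i ∨ i + 1 ≤ h
    · rw [p d]; ring
    · rw [q (by omega) (by omega)]
      have e1 : ¬ k ≤ i := by omega
      have e2 : h ≤ i := by omega
      simp only [cumw, if_neg e1, if_pos e2, if_pos hk.2]
      field_simp
      try ring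
  · rw [hT.2.1 h k (by omega), hT'.2.1 h k (by omega)]; simp

lemma SCS_eff (n : ℕ) : SubHighwayEfficient n (SCS n) := by
  rintro T hT a b ⟨ha, hab, hbn, hyp⟩
  obtain ⟨a, rfl⟩ : ∃ c, a = c + 1 := ⟨a - 1, by omega⟩
  rw [Icc_split _ a b (by omega), SCS_prefix n T hT b hbn, SCS_prefix n T hT a (by omega),
    sum_up n (a + 1) b (by omega) hbn]
  simp only [← Finset.sum_sub_distrib]
  refine Finset.sum_congr rfl fun h hh => ?_
  rw [mem_Icc] at hh
  rw [sum_up n h b hh.1 hbn]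
  have key : ∀ k ∈ Icc 1 n, T h k * cumw n h k b - T h k * cumw n h k a =
      if a + 1 ≤ h ∧ h ≤ b then (if h ≤ k ∧ k ≤ b then T h k else 0) else 0 := by
    intro k hk
    rw [mem_Icc] at hk
    by_cases c : h ≤ k
    · by_cases z : T h k = 0
      · simp [z]
      · have d : k ≤ a ∨ b < h ∨ (a + 1 ≤ h ∧ k ≤ b) := by
          by_contra hc
          apply z
          apply hyp h k hh.1 c hk.2
          · refine ⟨max h (a + 1), ?_⟩
            simp only [mem_inter, mem_Icc]
            omega
          · simp only [mem_Icc]; omega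
        unfold cumw
        split_ifs <;> first | (exfalso; omega) | simp
    · rw [hT.2.1 h k (by omega)]; simp
  rw [Finset.sum_congr rfl key]
  split_ifs <;> simp

noncomputable def cutT (T : ℕ → ℕ → ℝ) (i : ℕ) : ℕ → ℕ → ℝ :=
  fun h k => if h ≤ i ∧ i < k then 0 else T h k

lemma prefix_unique (n : ℕ) (f g : (ℕ → ℕ → ℝ) → ℕ → ℝ)
    (ff : TollComponentFairness n f) (fe : SubHighwayEfficient n f)
    (gf : TollComponentFairness n g) (ge : SubHighwayEfficient n g)
    (T : ℕ → ℕ → ℝ) (hT : IsTollMatrix n T) (i : ℕ) (hin : i ≤ n) :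
    ∑ j ∈ Icc 1 i, f T j = ∑ j ∈ Icc 1 i, g T j := by
  rcases Nat.eq_zero_or_pos i with rfl | hi
  · simp
  have tot : ∑ j ∈ Icc 1 n, f T j = ∑ j ∈ Icc 1 n, g T j := by
    have sh : IsSubHighway n T 1 n := by
      refine ⟨le_rfl, by omega, le_rfl, ?_⟩
      intro a b h1 h2 h3 _ h5
      exact absurd ⟨mem_Icc.2 ⟨h1, by omega⟩, mem_Icc.2 ⟨by omega, h3⟩⟩ h5
    rw [fe T hT 1 n sh, ge T hT 1 n sh]
  rcases hin.eq_or_lt with rfl | hlt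
  · exact tot
  have hC : IsTollMatrix n (cutT T i) := by
    refine ⟨fun h k => ?_, fun h k hh => ?_, fun h k hh => ?_⟩ <;> unfold cutT <;> split_ifs
    · exact le_rfl
    · exact hT.1 h k
    · rfl
    · exact hT.2.1 h k hh
    · rfl
    · exact hT.2.2 h k hh
  have sub1 : IsSubHighway n (cutT T i) 1 i := by
    refine ⟨le_rfl, hi, hin, ?_⟩
    rintro a b h1 h2 h3 ⟨x, hx⟩ h5
    simp only [mem_inter, mem_Icc] at hx h5
    unfold cutT
    rw [if_pos (by omega)]
  have sub2 : IsSubHighway n (cutT T i) (i + 1) n := by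
    refine ⟨by omega, hlt, le_rfl, ?_⟩
    rintro a b h1 h2 h3 ⟨x, hx⟩ h5
    simp only [mem_inter, mem_Icc] at hx h5
    unfold cutT
    rw [if_pos (by omega)]
  have hyp : ∀ h k, 1 ≤ h → h ≤ k → k ≤ n →
      ((k ≤ i ∨ i + 1 ≤ h) → cutT T i h k = T h k) ∧
      (h ≤ i → i < k → cutT T i h k = 0) := by
    intro h k h1 h2 h3
    refine ⟨fun h4 => ?_, fun h4 h5 => ?_⟩ <;> unfold cutT
    · rw [if_neg (by omega)]
    · rw [if_pos ⟨h4, h5⟩]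
  have F := ff T (cutT T i) hT hC i hi hlt hyp
  have G := gf T (cutT T i) hT hC i hi hlt hyp
  rw [Finset.sum_sub_distrib, Finset.sum_sub_distrib, fe _ hC _ _ sub1, fe _ hC _ _ sub2,
    Icc_split (f T) i n hin] at F
  rw [Finset.sum_sub_distrib, Finset.sum_sub_distrib, ge _ hC _ _ sub1, ge _ hC _ _ sub2,
    Icc_split (g T) i n hin, ← tot] at G
  have p1 : 0 < 1 / (i : ℝ) := by positivity
  have p2 : 0 < 1 / ((n : ℝ) - i) := by
    have : (i : ℝ) < n := by exact_mod_cast hlt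
    exact one_div_pos.2 (by linarith)
  have : (1 / (i : ℝ) + 1 / ((n : ℝ) - i)) *
      (∑ j ∈ Icc 1 i, f T j - ∑ j ∈ Icc 1 i, g T j) = 0 := by linear_combination F - G
  rcases mul_eq_zero.1 this with h | h <;> linarith

/-- The SCS method satisfies toll component fairness and sub-highway
efficiency, and it is the unique toll allocation method satisfying these two
properties. -/
theorem SCS_characterization_two (n : ℕ) (hn : 1 ≤ n) :
    (TollComponentFairness n (SCS n) ∧ SubHighwayEfficient n (SCS n)) ∧
    ∀ f, IsMethod n f → TollComponentFairness n f → SubHighwayEfficient n f →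
      ∀ T, IsTollMatrix n T → ∀ i ∈ Finset.Icc 1 n, f T i = SCS n T i := by
  refine ⟨⟨SCS_fair n, SCS_eff n⟩, ?_⟩
  intro f _ ff fe T hT i hi
  rw [mem_Icc] at hi
  obtain ⟨j, rfl⟩ : ∃ j, i = j + 1 := ⟨i - 1, by omega⟩
  have h1 := prefix_unique n f (SCS n) ff fe (SCS_fair n) (SCS_eff n) T hT j (by omega)
  have h2 := prefix_unique n f (SCS n) ff fe (SCS_fair n) (SCS_eff n) T hT (j + 1) hi.2
  rw [Finset.sum_Icc_succ_top (by omega), Finset.sum_Icc_succ_top (by omega)] at h2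
  linarith
end

section
/- For every n ≥ 1 and every toll matrix T, the Segments Compensated Sharing allocation coincides with the average tree solution of the segments allocation game on the line-graph: f^{Sc}_i(N,T) = AT_i(N, v^{Se}) for all i ∈ N. -/
open Finset

/-- The average tree solution of a TU-game on the line-graph `1 – 2 – ⋯ – n`,
where `L_i = {1,…,i−1}` and `R_i = {i+1,…,n}`. -/
noncomputable def ATsol (n : ℕ) (v : Finset ℕ → ℝ) (i : ℕ) : ℝ :=
  (1 / (n : ℝ)) *
    (((i : ℝ) - 1) * (v (insert i (Finset.Icc (i + 1) n)) - v (Finset.Icc (i + 1) n)) +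
      (v (Finset.Icc 1 n) - v (Finset.Icc 1 (i - 1)) - v (Finset.Icc (i + 1) n)) +
      ((n : ℝ) - (i : ℝ)) * (v (insert i (Finset.Icc 1 (i - 1))) - v (Finset.Icc 1 (i - 1))))

theorem vSe_Icc_aux (n : ℕ) (T : ℕ → ℕ → ℝ) (a b : ℕ) :
    vSe n T (Finset.Icc a b) = ∑ h ∈ Finset.Icc 1 n, ∑ k ∈ Finset.Icc 1 n,
      if a ≤ h ∧ h ≤ k ∧ k ≤ b then T h k else 0 := by
  unfold vSe
  refine Finset.sum_congr rfl fun h hh => ?_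
  rw [Finset.mem_Icc] at hh
  have hf : Finset.Icc h n = (Finset.Icc 1 n).filter (fun k => h ≤ k) := by
    ext k; simp only [Finset.mem_Icc, Finset.mem_filter]; omega
  rw [hf, Finset.sum_filter]
  refine Finset.sum_congr rfl fun k hk => ?_
  by_cases hk1 : h ≤ k
  · simp [hk1, Finset.Icc_subset_Icc_iff hk1]
  · simp [hk1]

theorem sum_box_aux (n : ℕ) (T : ℕ → ℕ → ℝ) (a b c d : ℕ) (ha : 1 ≤ a) (hb : b ≤ n)
    (hc : 1 ≤ c) (hd : d ≤ n) :
    ∑ h ∈ Finset.Icc a b, ∑ k ∈ Finset.Icc c d, T h k =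
      ∑ h ∈ Finset.Icc 1 n, ∑ k ∈ Finset.Icc 1 n,
      if (a ≤ h ∧ h ≤ b) ∧ (c ≤ k ∧ k ≤ d) then T h k else 0 := by
  have h1 : Finset.Icc a b = (Finset.Icc 1 n).filter (fun k => a ≤ k ∧ k ≤ b) := by
    ext k; simp only [Finset.mem_Icc, Finset.mem_filter]; omega
  have h2 : Finset.Icc c d = (Finset.Icc 1 n).filter (fun k => c ≤ k ∧ k ≤ d) := by
    ext k; simp only [Finset.mem_Icc, Finset.mem_filter]; omega
  rw [h1, h2, Finset.sum_filter]
  refine Finset.sum_congr rfl fun h _ => ?_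
  rw [Finset.sum_filter]
  by_cases hh : a ≤ h ∧ h ≤ b
  · simp [hh]
  · simp only [hh, false_and, if_false, Finset.sum_const_zero]

/-- The SCS allocation coincides with the average tree solution of the
segments allocation game on the line-graph. -/
theorem SCS_eq_AT (n : ℕ) (hn : 1 ≤ n) (T : ℕ → ℕ → ℝ) (hT : IsTollMatrix n T) :
    ∀ i ∈ Finset.Icc 1 n, SCS n T i = ATsol n (vSe n T) i := by
  intro i hi
  rw [Finset.mem_Icc] at hi
  obtain ⟨hi1, hi2⟩ := hi
  have e1 : insert i (Finset.Icc (i + 1) n) = Finset.Icc i n := by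
    ext k; simp only [Finset.mem_insert, Finset.mem_Icc]; omega
  have e2 : insert i (Finset.Icc 1 (i - 1)) = Finset.Icc 1 i := by
    ext k; simp only [Finset.mem_insert, Finset.mem_Icc]; omega
  have A : ∑ k ∈ Finset.Icc i n, T i k =
      vSe n T (Finset.Icc i n) - vSe n T (Finset.Icc (i + 1) n) := by
    have := sum_box_aux n T i i i n hi1 hi2 hi1 le_rfl
    rw [Finset.Icc_self, Finset.sum_singleton] at this
    rw [this, vSe_Icc_aux, vSe_Icc_aux]
    simp only [← Finset.sum_sub_distrib]
    refine Finset.sum_congr rfl fun h hh => Finset.sum_congr rfl fun k hk => ?_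
    rw [Finset.mem_Icc] at hh hk
    split_ifs <;> first | omega | simp
  have B : ∑ h ∈ Finset.Icc 1 i, ∑ k ∈ Finset.Icc i n, T h k =
      vSe n T (Finset.Icc 1 n) - vSe n T (Finset.Icc 1 (i - 1))
        - vSe n T (Finset.Icc (i + 1) n) := by
    rw [sum_box_aux n T 1 i i n le_rfl hi2 hi1 le_rfl, vSe_Icc_aux, vSe_Icc_aux, vSe_Icc_aux]
    simp only [← Finset.sum_sub_distrib]
    refine Finset.sum_congr rfl fun h hh => Finset.sum_congr rfl fun k hk => ?_
    rw [Finset.mem_Icc] at hh hk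
    split_ifs <;> first | omega | simp
  have C : ∑ h ∈ Finset.Icc 1 i, T h i =
      vSe n T (Finset.Icc 1 i) - vSe n T (Finset.Icc 1 (i - 1)) := by
    have := sum_box_aux n T 1 i i i le_rfl hi2 hi1 hi2
    simp only [Finset.Icc_self, Finset.sum_singleton] at this
    rw [this, vSe_Icc_aux, vSe_Icc_aux]
    simp only [← Finset.sum_sub_distrib]
    refine Finset.sum_congr rfl fun h hh => Finset.sum_congr rfl fun k hk => ?_
    rw [Finset.mem_Icc] at hh hk
    split_ifs <;> first | omega | simp
  unfold SCS ATsol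
  rw [e1, e2, A, B, C]
end

section
/- For every n ≥ 1 and every toll matrix T, a vector x ∈ ℝ^N belongs to the core C(N, v^{Se}) of the segments allocation game if and only if there exist nonnegative real weights α^i_{hk}, defined for all h ≤ k and i ∈ 𝒫([h,k]), such that Σ_{i=h}^{k} α^i_{hk} = 1 for every h ≤ k, and x_i = Σ_{h=1}^{i} Σ_{k=i}^{n} α^i_{hk}·t_{hk} for every i ∈ N. -/
open Finset

/-- The core of the TU-game `v` on player set `{1,…,n}`. -/
def InCore (n : ℕ) (v : Finset ℕ → ℝ) (x : ℕ → ℝ) : Prop :=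
  (∑ i ∈ Finset.Icc 1 n, x i = v (Finset.Icc 1 n)) ∧
    ∀ S ⊆ Finset.Icc 1 n, v S ≤ ∑ i ∈ S, x i

/-- Splitting off one unanimity game from a supermodular game. -/
theorem split_one (N : Finset ℕ) (f : Finset ℕ → ℝ)
    (hf : ∀ S S' : Finset ℕ, f S + f S' ≤ f (S ∪ S') + f (S ∩ S'))
    (P : Finset ℕ) (hP : P.Nonempty) :
    ∀ (t : ℝ) (x : ℕ → ℝ), 0 ≤ t → P ⊆ N →
      (∀ S ⊆ N, f S + (if P ⊆ S then t else 0) ≤ ∑ i ∈ S, x i) →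
      ∃ β : ℕ → ℝ, (∀ i, 0 ≤ β i) ∧ (∀ i, i ∉ P → β i = 0) ∧ (∑ i ∈ P, β i = t) ∧
        ∀ S ⊆ N, f S ≤ ∑ i ∈ S, (x i - β i) := by
  induction hP using Finset.Nonempty.cons_induction with
  | singleton a =>
    intro t x ht hPN hx
    refine ⟨fun i => if i = a then t else 0, ?_, ?_, ?_, ?_⟩
    · intro i; dsimp only; split_ifs <;> simp [ht]
    · intro i hi; simp at hi; simp [hi]
    · simp
    · intro S hS
      have := hx S hS
      simp only [Finset.singleton_subset_iff] at this
      rw [Finset.sum_sub_distrib, Finset.sum_ite_eq']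
      linarith
  | cons a A ha hA ih =>
    intro t x ht hPN hx
    rw [Finset.cons_eq_insert] at *
    have haN : a ∈ N := hPN (Finset.mem_insert_self _ _)
    have hAN : A ⊆ N := fun i hi => hPN (Finset.mem_insert_of_mem hi)
    have hx0 : ∀ S ⊆ N, f S ≤ ∑ i ∈ S, x i := by
      intro S hS
      have := hx S hS
      split_ifs at this <;> linarith
    -- candidate upper bounds
    obtain ⟨ε, hε0, hεt, hup, hlow⟩ : ∃ ε : ℝ, 0 ≤ ε ∧ ε ≤ t ∧
        (∀ S ⊆ N, a ∈ S → ¬ A ⊆ S → f S + ε ≤ ∑ i ∈ S, x i) ∧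
        (∀ S ⊆ N, a ∉ S → A ⊆ S → f S + (t - ε) ≤ ∑ i ∈ S, x i) := by
      let U : Finset ℝ := insert t ((N.powerset.filter (fun S => a ∈ S ∧ ¬ A ⊆ S)).image
        (fun S => ∑ i ∈ S, x i - f S))
      have hU : U.Nonempty := Finset.insert_nonempty _ _
      have hmem := Finset.min'_mem U hU
      have hle : ∀ u ∈ U, U.min' hU ≤ u := fun u hu => Finset.min'_le U u hu
      refine ⟨U.min' hU, ?_, hle t (Finset.mem_insert_self _ _), ?_, ?_⟩
      · rcases Finset.mem_insert.1 hmem with h | h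
        · rw [h]; exact ht
        · obtain ⟨S, hS, h⟩ := Finset.mem_image.1 h
          rw [← h]
          have := hx0 S (Finset.mem_powerset.1 (Finset.mem_filter.1 hS).1)
          linarith
      · intro S hS h1 h2
        have := hle (∑ i ∈ S, x i - f S) (Finset.mem_insert_of_mem (Finset.mem_image.2
          ⟨S, Finset.mem_filter.2 ⟨Finset.mem_powerset.2 hS, h1, h2⟩, rfl⟩))
        linarith
      · intro S' hS' h1 h2
        rcases Finset.mem_insert.1 hmem with h | h
        · rw [h]
          have := hx0 S' hS'
          linarith
        · obtain ⟨S, hS, h⟩ := Finset.mem_image.1 h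
          rw [← h]
          obtain ⟨hS, hS1, hS2⟩ := Finset.mem_filter.1 hS
          have hS := Finset.mem_powerset.1 hS
          have e1 := hx (S ∪ S') (Finset.union_subset hS hS')
          rw [if_pos (Finset.insert_subset (Finset.mem_union_left _ hS1)
            (h2.trans Finset.subset_union_right))] at e1
          have e2 := hx0 (S ∩ S') (Finset.inter_subset_left.trans hS)
          have e3 := hf S S'
          have e4 := Finset.sum_union_inter (s₁ := S) (s₂ := S') (f := x)
          linarith
    obtain ⟨β, hb0, hbs, hbt, hbx⟩ := ih (t - ε) (fun i => x i - if i = a then ε else 0)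
      (by linarith) hAN (by
        intro S hS
        rw [Finset.sum_sub_distrib, Finset.sum_ite_eq']
        have h0 := hx0 S hS
        have h1 := hx S hS
        have h2 := hup S hS
        have h3 := hlow S hS
        simp only [Finset.insert_subset_iff] at h1
        by_cases c1 : a ∈ S <;> by_cases c2 : A ⊆ S <;> simp [c1, c2] at h1 h2 h3 ⊢ <;> linarith)
    refine ⟨fun i => β i + if i = a then ε else 0, ?_, ?_, ?_, ?_⟩
    · intro i
      have := hb0 i
      dsimp only
      split_ifs <;> linarith
    · intro i hi
      simp only [Finset.mem_insert, not_or] at hi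
      simp [hi.1, hbs i hi.2]
    · rw [Finset.sum_add_distrib, Finset.sum_ite_eq', Finset.sum_insert ha, hbs a ha, hbt]
      simp
    · intro S hS
      refine (hbx S hS).trans (le_of_eq (Finset.sum_congr rfl fun i _ => ?_))
      ring

theorem split_all {ι : Type} [DecidableEq ι] (N : Finset ℕ) (P : ι → Finset ℕ) (t : ι → ℝ)
    (J : Finset ι) :
    (∀ j ∈ J, (P j).Nonempty ∧ P j ⊆ N ∧ 0 ≤ t j) → ∀ x : ℕ → ℝ,
      (∀ S ⊆ N, ∑ j ∈ J, (if P j ⊆ S then t j else 0) ≤ ∑ i ∈ S, x i) →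
      ∃ β : ι → ℕ → ℝ, (∀ j ∈ J, ∀ i, 0 ≤ β j i) ∧ (∀ j ∈ J, ∀ i, i ∉ P j → β j i = 0) ∧
        (∀ j ∈ J, ∑ i ∈ P j, β j i = t j) ∧ ∀ i ∈ N, ∑ j ∈ J, β j i ≤ x i := by
  induction J using Finset.induction_on with
  | empty =>
    intro _ x hx
    refine ⟨fun _ _ => 0, by simp, by simp, by simp, ?_⟩
    intro i hi
    simpa using hx {i} (by simpa using hi)
  | insert j J hj ih =>
    intro hJ x hx
    obtain ⟨h1, h2, h3⟩ := hJ j (Finset.mem_insert_self _ _)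
    have hJ' : ∀ j ∈ J, (P j).Nonempty ∧ P j ⊆ N ∧ 0 ≤ t j :=
      fun j hj => hJ j (Finset.mem_insert_of_mem hj)
    obtain ⟨b, hb0, hbs, hbt, hbx⟩ := split_one N
      (fun S => ∑ j ∈ J, (if P j ⊆ S then t j else 0)) (by
        intro S S'
        simp only [← Finset.sum_add_distrib]
        refine Finset.sum_le_sum fun j hj => ?_
        have ht := (hJ' j hj).2.2
        have k1 : P j ⊆ S → P j ⊆ S ∪ S' := fun h => h.trans Finset.subset_union_left
        have k2 : P j ⊆ S' → P j ⊆ S ∪ S' := fun h => h.trans Finset.subset_union_right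
        simp only [Finset.subset_inter_iff]
        by_cases c1 : P j ⊆ S <;> by_cases c2 : P j ⊆ S' <;> simp [c1, c2, k1, k2]
        split_ifs <;> simp [ht]) (P j) h1 (t j) x h3 h2 (by
        intro S hS
        have := hx S hS
        rw [Finset.sum_insert hj] at this
        linarith)
    obtain ⟨β, c0, cs, ct, cx⟩ := ih hJ' (fun i => x i - b i) hbx
    have hne : ∀ j' ∈ J, j' ≠ j := fun j' h e => hj (e ▸ h)
    refine ⟨fun j' => if j' = j then b else β j', ?_, ?_, ?_, ?_⟩
    · intro j' hj'
      rcases Finset.mem_insert.1 hj' with rfl | h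
      · simpa using hb0
      · simpa [hne j' h] using c0 j' h
    · intro j' hj'
      rcases Finset.mem_insert.1 hj' with rfl | h
      · simpa using hbs
      · simpa [hne j' h] using cs j' h
    · intro j' hj'
      rcases Finset.mem_insert.1 hj' with rfl | h
      · simpa using hbt
      · simpa [hne j' h] using ct j' h
    · intro i hi
      rw [Finset.sum_insert hj, Finset.sum_congr rfl
        (fun j' h => by simp [hne j' h] : ∀ j' ∈ J, _ = β j' i)]
      have := cx i hi
      simp only [if_true]
      linarith

theorem sum_swap_aux (n i : ℕ) (hi : i ∈ Finset.Icc 1 n) (F : ℕ → ℕ → ℝ) :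
    ∑ h ∈ Finset.Icc 1 i, ∑ k ∈ Finset.Icc i n, F h k =
      ∑ h ∈ Finset.Icc 1 n, ∑ k ∈ Finset.Icc h n, if i ∈ Finset.Icc h k then F h k else 0 := by
  rw [Finset.mem_Icc] at hi
  rw [← Finset.sum_subset (Finset.Icc_subset_Icc_right hi.2 : Finset.Icc 1 i ⊆ Finset.Icc 1 n)]
  · refine Finset.sum_congr rfl fun h hh => ?_
    rw [Finset.mem_Icc] at hh
    rw [← Finset.sum_filter]
    refine Finset.sum_congr ?_ fun _ _ => rfl
    ext k
    simp only [Finset.mem_filter, Finset.mem_Icc]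
    omega
  · intro h hh hh'
    refine Finset.sum_eq_zero fun k _ => if_neg ?_
    simp only [Finset.mem_Icc] at *
    omega

/-- A vector belongs to the core of the segments allocation game iff it can be
obtained from nonnegative weights `α^i_{hk}` (for `h ≤ k` and `i ∈ 𝒫([h,k])`)
summing to one over each trip. -/
theorem core_eq_weighted_allocations (n : ℕ) (hn : 1 ≤ n) (T : ℕ → ℕ → ℝ)
    (hT : IsTollMatrix n T) (x : ℕ → ℝ) :
    InCore n (vSe n T) x ↔
      ∃ α : ℕ → ℕ → ℕ → ℝ,
        (∀ h k, 1 ≤ h → h ≤ k → k ≤ n → ∀ i ∈ Finset.Icc h k, 0 ≤ α h k i) ∧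
        (∀ h k, 1 ≤ h → h ≤ k → k ≤ n → ∑ i ∈ Finset.Icc h k, α h k i = 1) ∧
        (∀ i ∈ Finset.Icc 1 n,
          x i = ∑ h ∈ Finset.Icc 1 i, ∑ k ∈ Finset.Icc i n, α h k i * T h k) := by
  obtain ⟨hT0, -, -⟩ := hT
  constructor
  · rintro ⟨hN, hS⟩
    let J : Finset ((_ : ℕ) × ℕ) := (Finset.Icc 1 n).sigma (fun h => Finset.Icc h n)
    have hJm : ∀ h k, (⟨h, k⟩ : (_ : ℕ) × ℕ) ∈ J ↔ 1 ≤ h ∧ h ≤ k ∧ k ≤ n := by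
      intro h k
      simp only [J, Finset.mem_sigma, Finset.mem_Icc]
      omega
    have hv : ∀ S, vSe n T S =
        ∑ j ∈ J, if Finset.Icc j.1 j.2 ⊆ S then T j.1 j.2 else 0 := by
      intro S
      simp only [vSe, J, Finset.sum_sigma]
    have hsub : ∀ j ∈ J, (Finset.Icc j.1 j.2).Nonempty ∧ Finset.Icc j.1 j.2 ⊆ Finset.Icc 1 n ∧
        0 ≤ T j.1 j.2 := by
      rintro ⟨h, k⟩ hj
      obtain ⟨h1, h2, h3⟩ := (hJm h k).1 hj
      exact ⟨Finset.nonempty_Icc.2 h2, Finset.Icc_subset_Icc h1 h3, hT0 _ _⟩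
    obtain ⟨β, b0, bs, bt, bx⟩ := split_all (Finset.Icc 1 n)
      (fun j : (_ : ℕ) × ℕ => Finset.Icc j.1 j.2) (fun j => T j.1 j.2) J hsub x (by
        intro S h
        have := hS S h
        rwa [hv] at this)
    have htot : ∑ i ∈ Finset.Icc 1 n, ∑ j ∈ J, β j i = ∑ i ∈ Finset.Icc 1 n, x i := by
      rw [hN, hv, Finset.sum_comm]
      refine Finset.sum_congr rfl fun j hj => ?_
      rw [if_pos (hsub j hj).2.1, ← bt j hj]
      exact (Finset.sum_subset (hsub j hj).2.1 fun i _ hi => bs j hj i hi).symm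
    have hxe := (Finset.sum_eq_sum_iff_of_le bx).1 htot
    refine ⟨fun h k i => if T h k = 0 then (if i = h then 1 else 0) else β ⟨h, k⟩ i / T h k,
      ?_, ?_, ?_⟩
    · intro h k h1 h2 h3 i hi
      have := b0 ⟨h, k⟩ ((hJm h k).2 ⟨h1, h2, h3⟩) i
      have := hT0 h k
      dsimp only
      split_ifs <;> positivity
    · intro h k h1 h2 h3
      have := bt ⟨h, k⟩ ((hJm h k).2 ⟨h1, h2, h3⟩)
      by_cases c : T h k = 0
      · simp [c, h2]
      · simp only [c, if_false]
        rw [← Finset.sum_div, this, div_self c]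
    · intro i hi
      rw [← hxe i hi, sum_swap_aux n i hi]
      simp only [J, Finset.sum_sigma]
      refine Finset.sum_congr rfl fun h hh => Finset.sum_congr rfl fun k hk => ?_
      have hj : (⟨h, k⟩ : (_ : ℕ) × ℕ) ∈ J := Finset.mem_sigma.2 ⟨hh, hk⟩
      by_cases hm : i ∈ Finset.Icc h k
      · rw [if_pos hm]
        by_cases c : T h k = 0
        · have e := bt _ hj
          dsimp only at e
          rw [c] at e
          have := (Finset.sum_eq_zero_iff_of_nonneg (fun i _ => b0 _ hj i)).1 e i hm
          rw [this, c, mul_zero]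
        · rw [if_neg c, div_mul_cancel₀ _ c]
      · rw [if_neg hm]
        exact bs _ hj i hm
  · rintro ⟨α, a0, a1, ax⟩
    have key : ∀ S ⊆ Finset.Icc 1 n, ∑ i ∈ S, x i = ∑ h ∈ Finset.Icc 1 n, ∑ k ∈ Finset.Icc h n,
        ∑ i ∈ S, if i ∈ Finset.Icc h k then α h k i * T h k else 0 := by
      intro S hS
      rw [Finset.sum_congr rfl fun i hi => (ax i (hS hi)).trans (sum_swap_aux n i (hS hi) _),
        Finset.sum_comm]
      exact Finset.sum_congr rfl fun h _ => Finset.sum_comm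
    have full : ∀ S, ∀ h k, 1 ≤ h → h ≤ k → k ≤ n → Finset.Icc h k ⊆ S →
        ∑ i ∈ S, (if i ∈ Finset.Icc h k then α h k i * T h k else 0) = T h k := by
      intro S h k h1 h2 h3 hs
      rw [Finset.sum_ite_mem, Finset.inter_eq_right.2 hs, ← Finset.sum_mul, a1 h k h1 h2 h3,
        one_mul]
    constructor
    · rw [key _ subset_rfl, vSe]
      refine Finset.sum_congr rfl fun h hh => Finset.sum_congr rfl fun k hk => ?_
      rw [Finset.mem_Icc] at hh hk
      have hs := Finset.Icc_subset_Icc hh.1 hk.2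
      rw [if_pos hs, full _ h k hh.1 hk.1 hk.2 hs]
    · intro S hS
      rw [key _ hS, vSe]
      refine Finset.sum_le_sum fun h hh => Finset.sum_le_sum fun k hk => ?_
      rw [Finset.mem_Icc] at hh hk
      by_cases hs : Finset.Icc h k ⊆ S
      · rw [if_pos hs, full _ h k hh.1 hk.1 hk.2 hs]
      · rw [if_neg hs]
        refine Finset.sum_nonneg fun i _ => ?_
        split_ifs with hm
        · exact mul_nonneg (a0 h k hh.1 hk.1 hk.2 i hm) (hT0 _ _)
        · exact le_rfl
end

section
/- For every n ≥ 1, if a toll allocation method f satisfies efficiency, additivity, and the inessential segment property, then for every toll matrix T the allocation f(N,T) belongs to the core C(N, v^{Se}) of the segments allocation game associated with T. -/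
open Finset

/-- Any toll allocation method satisfying efficiency, additivity and the
inessential segment property yields core allocations of the segments
allocation game. -/
theorem method_in_core (n : ℕ) (hn : 1 ≤ n) (f : (ℕ → ℕ → ℝ) → ℕ → ℝ)
    (hf : IsMethod n f) (heff : Efficient n f) (hadd : AdditiveMethod n f)
    (hin : InessentialSegment n f) :
    ∀ T, IsTollMatrix n T → InCore n (vSe n T) (f T) := by
  intro T hT
  constructor
  · rw [heff T hT]
    unfold vSe
    refine Finset.sum_congr rfl fun h hh => Finset.sum_congr rfl fun k hk => ?_
    rw [Finset.mem_Icc] at hh hk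
    rw [if_pos (Finset.Icc_subset_Icc hh.1 hk.2)]
  · intro S hS
    obtain ⟨h0, h1, h2⟩ := hT
    have hA : IsTollMatrix n (fun h k => if Finset.Icc h k ⊆ S then T h k else 0) := by
      refine ⟨fun h k => ?_, fun h k hk => ?_, fun h k hk => ?_⟩
      · dsimp only
        split_ifs
        · exact h0 h k
        · exact le_rfl
      · simp [h1 h k hk]
      · simp [h2 h k hk]
    have hB : IsTollMatrix n (fun h k => if Finset.Icc h k ⊆ S then 0 else T h k) := by
      refine ⟨fun h k => ?_, fun h k hk => ?_, fun h k hk => ?_⟩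
      · dsimp only
        split_ifs
        · exact le_rfl
        · exact h0 h k
      · simp [h1 h k hk]
      · simp [h2 h k hk]
    have hsum : (fun h k => (fun h k => if Finset.Icc h k ⊆ S then T h k else 0) h k +
        (fun h k => if Finset.Icc h k ⊆ S then 0 else T h k) h k) = T := by
      funext h k
      dsimp only
      split_ifs <;> simp
    have hv : vSe n T S =
        ∑ i ∈ S, f (fun h k => if Finset.Icc h k ⊆ S then T h k else 0) i := by
      unfold vSe
      rw [← heff _ hA]
      symm
      refine Finset.sum_subset hS fun i hi hiS => hin _ hA i hi fun h k _ hhi hik _ => ?_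
      exact if_neg fun hsub => hiS (hsub (Finset.mem_Icc.2 ⟨hhi, hik⟩))
    rw [hv]
    refine Finset.sum_le_sum fun i hi => ?_
    have e := hadd _ _ hA hB i (hS hi)
    rw [hsum] at e
    rw [e]
    exact le_add_of_nonneg_right (hf _ hB i (hS hi))
end

section
/- For every n ≥ 1 and every toll matrix T, the Segments Equal Sharing allocation belongs to the core of the segments allocation game: f^{Se}(N,T) ∈ C(N, v^{Se}). -/
open Finset

lemma SES_sum (n : ℕ) (T : ℕ → ℕ → ℝ) (S : Finset ℕ) (hS : S ⊆ Finset.Icc 1 n) :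
    ∑ i ∈ S, SES n T i = ∑ h ∈ Finset.Icc 1 n, ∑ k ∈ Finset.Icc h n,
      ∑ i ∈ S, if i ∈ Finset.Icc h k then T h k / ((k : ℝ) - (h : ℝ) + 1) else 0 := by
  have e : ∀ i ∈ S, SES n T i = ∑ h ∈ Finset.Icc 1 n, ∑ k ∈ Finset.Icc h n,
      if i ∈ Finset.Icc h k then T h k / ((k : ℝ) - (h : ℝ) + 1) else 0 := by
    intro i hi
    have hi' := Finset.mem_Icc.1 (hS hi)
    unfold SES
    have h1 : ∀ h ∈ Finset.Icc 1 i, ∑ k ∈ Finset.Icc i n, T h k / ((k : ℝ) - (h : ℝ) + 1)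
        = ∑ k ∈ Finset.Icc h n,
          if i ∈ Finset.Icc h k then T h k / ((k : ℝ) - (h : ℝ) + 1) else 0 := by
      intro h hh
      have hh' := Finset.mem_Icc.1 hh
      rw [← Finset.sum_filter]
      apply Finset.sum_congr _ (fun _ _ => rfl)
      ext k
      simp only [Finset.mem_filter, Finset.mem_Icc]
      omega
    rw [Finset.sum_congr rfl h1]
    apply Finset.sum_subset
    · exact Finset.Icc_subset_Icc_right hi'.2
    · intro h hh hn
      apply Finset.sum_eq_zero
      intro k _
      simp only [Finset.mem_Icc] at *
      rw [if_neg (by omega)]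
  rw [Finset.sum_congr rfl e, Finset.sum_comm]
  apply Finset.sum_congr rfl
  intro h _
  rw [Finset.sum_comm]

lemma SES_inner (T : ℕ → ℕ → ℝ) (S : Finset ℕ) (h k : ℕ) (hk : h ≤ k)
    (hs : Finset.Icc h k ⊆ S) :
    (∑ i ∈ S, if i ∈ Finset.Icc h k then T h k / ((k : ℝ) - (h : ℝ) + 1) else 0) = T h k := by
  rw [← Finset.sum_filter]
  have : S.filter (fun i => i ∈ Finset.Icc h k) = Finset.Icc h k := by
    ext i
    rw [Finset.mem_filter]
    exact ⟨fun a => a.2, fun a => ⟨hs a, a⟩⟩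
  rw [this, Finset.sum_const, Nat.card_Icc, nsmul_eq_mul, Nat.cast_sub (by omega)]
  have : (h : ℝ) ≤ k := by exact_mod_cast hk
  have : (k : ℝ) - h + 1 ≠ 0 := by linarith
  push_cast
  field_simp
  ring

/-- The SES allocation belongs to the core of the segments allocation game. -/
theorem SES_in_core (n : ℕ) (hn : 1 ≤ n) (T : ℕ → ℕ → ℝ) (hT : IsTollMatrix n T) :
    InCore n (vSe n T) (SES n T) := by
  constructor
  · rw [SES_sum n T _ (Finset.Subset.refl _)]
    unfold vSe
    refine Finset.sum_congr rfl fun h hh => Finset.sum_congr rfl fun k hk => ?_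
    simp only [Finset.mem_Icc] at hh hk
    have hs : Finset.Icc h k ⊆ Finset.Icc 1 n := Finset.Icc_subset_Icc hh.1 hk.2
    rw [if_pos hs, SES_inner T _ h k hk.1 hs]
  · intro S hS
    rw [SES_sum n T S hS]
    unfold vSe
    refine Finset.sum_le_sum fun h hh => Finset.sum_le_sum fun k hk => ?_
    simp only [Finset.mem_Icc] at hh hk
    by_cases hs : Finset.Icc h k ⊆ S
    · rw [if_pos hs, SES_inner T _ h k hk.1 hs]
    · rw [if_neg hs]
      apply Finset.sum_nonneg
      intro i _
      have : (h : ℝ) ≤ k := by exact_mod_cast hk.1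
      split_ifs
      · exact div_nonneg (hT.1 h k) (by linarith)
      · exact le_refl _
end

section
/- Let n ≥ 1 and let T be a toll matrix with D(T) > 0, and set β = (Σ_{h≤k} t_{hk} − Σ_{j=1}^{n} t_{jj}) / D(T). Then the Segments Proportional Sharing allocation f^{Sp}(N,T) belongs to the core C(N, v^{Se}) if and only if for every nonempty connected coalition S ⊊ N one has β · Σ_{i∈S}(Σ_{h≤i≤k} t_{hk} − t_{ii}) ≥ Σ_{h≤k, 𝒫([h,k]) ⊆ S} t_{hk} − Σ_{i∈S} t_{ii}. -/
open Finset

lemma vSe_Icc (n : ℕ) (T : ℕ → ℕ → ℝ) (a b : ℕ) (ha : 1 ≤ a) (hb : b ≤ n) :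
    vSe n T (Finset.Icc a b) = ∑ h ∈ Finset.Icc a b, ∑ k ∈ Finset.Icc h b, T h k := by
  unfold vSe
  have hsub : Finset.Icc a b ⊆ Finset.Icc 1 n := Finset.Icc_subset_Icc ha hb
  symm
  rw [← Finset.sum_subset hsub]
  · apply Finset.sum_congr rfl
    intro h hh
    rw [Finset.mem_Icc] at hh
    have hs : Finset.Icc h b ⊆ Finset.Icc h n := Finset.Icc_subset_Icc le_rfl hb
    rw [← Finset.sum_subset hs]
    · apply Finset.sum_congr rfl
      intro k hk
      rw [Finset.mem_Icc] at hk
      rw [if_pos (Finset.Icc_subset_Icc hh.1 hk.2)]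
    · intro k hk hk'
      rw [Finset.mem_Icc] at hk hk'
      rw [if_neg]
      intro hc
      have := hc (Finset.mem_Icc.2 ⟨hk.1, le_rfl⟩)
      rw [Finset.mem_Icc] at this
      omega
  · intro h hh hh'
    apply Finset.sum_eq_zero
    intro k hk
    rw [Finset.mem_Icc] at hk
    rw [if_neg]
    intro hc
    exact hh' (hc (Finset.mem_Icc.2 ⟨le_rfl, hk.1⟩))

lemma vSe_split (n : ℕ) (T : ℕ → ℕ → ℝ) (hT : ∀ h k, 0 ≤ T h k) (S : Finset ℕ) (m b : ℕ)
    (hm : ∀ x ∈ S, m ≤ x) (hb : b + 1 ∉ S) :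
    vSe n T S ≤ vSe n T (Finset.Icc m b) + vSe n T (S \ Finset.Icc m b) := by
  unfold vSe
  rw [← Finset.sum_add_distrib]
  apply Finset.sum_le_sum
  intro h _
  rw [← Finset.sum_add_distrib]
  apply Finset.sum_le_sum
  intro k hk
  rw [Finset.mem_Icc] at hk
  have h0 := hT h k
  by_cases hS : Finset.Icc h k ⊆ S
  · rw [if_pos hS]
    have hmh := hm h (hS (Finset.mem_Icc.2 ⟨le_rfl, hk.1⟩))
    by_cases hhb : h ≤ b
    · have hkb : k ≤ b := by
        by_contra hc
        exact hb (hS (Finset.mem_Icc.2 ⟨by omega, by omega⟩))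
      rw [if_pos (Finset.Icc_subset_Icc hmh hkb)]
      split_ifs <;> linarith
    · have : Finset.Icc h k ⊆ S \ Finset.Icc m b := by
        intro x hx
        refine Finset.mem_sdiff.2 ⟨hS hx, ?_⟩
        rw [Finset.mem_Icc] at hx ⊢
        omega
      rw [if_pos this]
      split_ifs <;> linarith
  · rw [if_neg hS]
    split_ifs <;> linarith

lemma core_of_connected (n : ℕ) (T : ℕ → ℕ → ℝ) (hT : ∀ h k, 0 ≤ T h k) (x : ℕ → ℝ)
    (H : ∀ a b, 1 ≤ a → a ≤ b → b ≤ n → vSe n T (Finset.Icc a b) ≤ ∑ i ∈ Finset.Icc a b, x i)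
    (S : Finset ℕ) : S ⊆ Finset.Icc 1 n → vSe n T S ≤ ∑ i ∈ S, x i := by
  induction S using Finset.strongInduction with
  | H S ih =>
    intro hS
    rcases S.eq_empty_or_nonempty with rfl | hne
    · unfold vSe
      rw [Finset.sum_empty]
      apply le_of_eq
      apply Finset.sum_eq_zero
      intro h _
      apply Finset.sum_eq_zero
      intro k hk
      rw [Finset.mem_Icc] at hk
      rw [if_neg]
      intro hc
      exact Finset.notMem_empty h (hc (Finset.mem_Icc.2 ⟨le_rfl, hk.1⟩))
    · have hmS := S.min'_mem hne
      have hmin : ∀ y ∈ S, S.min' hne ≤ y := fun y hy => S.min'_le y hy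
      generalize S.min' hne = m at hmS hmin
      have hm1 := Finset.mem_Icc.1 (hS hmS)
      have hex : ∃ b, m ≤ b ∧ b + 1 ∉ S := by
        refine ⟨n, hm1.2, fun hc => ?_⟩
        have := Finset.mem_Icc.1 (hS hc)
        omega
      obtain ⟨b, hmb, hbS, hbmin⟩ : ∃ b, m ≤ b ∧ b + 1 ∉ S ∧
          ∀ c < b, ¬ (m ≤ c ∧ c + 1 ∉ S) := by
        classical
        exact ⟨Nat.find hex, (Nat.find_spec hex).1, (Nat.find_spec hex).2,
          fun c hc => Nat.find_min hex hc⟩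
      have hsub : Finset.Icc m b ⊆ S := by
        intro y hy
        rw [Finset.mem_Icc] at hy
        by_cases hym : y = m
        · rw [hym]; exact hmS
        · by_contra hc
          refine hbmin (y - 1) (by omega) ⟨by omega, ?_⟩
          rwa [Nat.sub_add_cancel (by omega)]
      have hbn := (Finset.mem_Icc.1 (hS (hsub (Finset.mem_Icc.2 ⟨hmb, le_rfl⟩)))).2
      have h1 := vSe_split n T hT S m b hmin hbS
      have h2 := H m b hm1.1 hmb hbn
      have h3 := ih (S \ Finset.Icc m b)
        (Finset.sdiff_ssubset hsub ⟨m, Finset.mem_Icc.2 ⟨le_rfl, hmb⟩⟩)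
        (Finset.sdiff_subset.trans hS)
      have h4 := Finset.sum_sdiff (f := x) hsub
      linarith

/-- The SPS allocation is a core allocation of the segments allocation game
iff for every nonempty connected proper coalition `S = {a,…,b}` one has
`β · Σ_{i∈S}(Σ_{h≤i≤k} t_{hk} − t_{ii}) ≥ Σ_{𝒫([h,k])⊆S} t_{hk} − Σ_{i∈S} t_{ii}`. -/
theorem SPS_in_core_iff (n : ℕ) (hn : 1 ≤ n) (T : ℕ → ℕ → ℝ)
    (hT : IsTollMatrix n T) (hD : 0 < Dsep n T) (β : ℝ)
    (hβ : β = ((∑ h ∈ Finset.Icc 1 n, ∑ k ∈ Finset.Icc h n, T h k) -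
      ∑ j ∈ Finset.Icc 1 n, T j j) / Dsep n T) :
    InCore n (vSe n T) (SPS n T) ↔
      ∀ a b, 1 ≤ a → a ≤ b → b ≤ n → Finset.Icc a b ≠ Finset.Icc 1 n →
        (∑ h ∈ Finset.Icc a b, ∑ k ∈ Finset.Icc h b, T h k) -
            ∑ i ∈ Finset.Icc a b, T i i ≤
          β * ∑ i ∈ Finset.Icc a b, (tripTollAt n T i - T i i) := by
  have hx : ∀ S : Finset ℕ, ∑ i ∈ S, SPS n T i =
      ∑ i ∈ S, T i i + β * ∑ i ∈ S, (tripTollAt n T i - T i i) := by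
    intro S
    rw [Finset.mul_sum, ← Finset.sum_add_distrib]
    apply Finset.sum_congr rfl
    intro i _
    unfold SPS
    rw [if_pos hD, hβ]
    ring
  have heff : ∑ i ∈ Finset.Icc 1 n, SPS n T i = vSe n T (Finset.Icc 1 n) := by
    rw [hx, vSe_Icc n T 1 n le_rfl le_rfl]
    change _ + β * Dsep n T = _
    rw [hβ, div_mul_cancel₀ _ hD.ne']
    ring
  constructor
  · rintro ⟨_, hc⟩ a b ha _ hb _
    have h := hc (Finset.Icc a b) (Finset.Icc_subset_Icc ha hb)
    rw [hx, vSe_Icc n T a b ha hb] at h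
    linarith
  · intro H
    refine ⟨heff, core_of_connected n T hT.1 _ ?_⟩
    intro a b ha hab hb
    by_cases he : Finset.Icc a b = Finset.Icc 1 n
    · rw [he, heff]
    · have h := H a b ha hab hb he
      rw [hx, vSe_Icc n T a b ha hb]
      linarith
end

section
/- If n = 3 or n = 4, then for every toll matrix T the Segments Proportional Sharing allocation belongs to the core of the segments allocation game: f^{Sp}(N,T) ∈ C(N, v^{Se}). -/
open Finset

lemma sum_subset_ite (n : ℕ) (S : Finset ℕ) (hS : S ⊆ Finset.Icc 1 n) (x : ℕ → ℝ) :
    ∑ i ∈ S, x i = ∑ i ∈ Finset.Icc 1 n, if i ∈ S then x i else 0 := by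
  rw [← Finset.sum_filter]
  congr 1
  ext i
  simp only [Finset.mem_filter]
  exact ⟨fun h => ⟨hS h, h⟩, fun h => h.2⟩

lemma sps_div_helper (s W D V v : ℝ) (hD : 0 < D) (h : (v - s) * D ≤ W * V) :
    v ≤ s + W / D * V := by
  have : v - s ≤ W * V / D := (le_div_iff₀ hD).2 h
  have e : W / D * V = W * V / D := by ring
  rw [e]; linarith

lemma SPS_sum (n : ℕ) (T : ℕ → ℕ → ℝ) (S : Finset ℕ) (hD : 0 < Dsep n T) :
    ∑ i ∈ S, SPS n T i = ∑ i ∈ S, T i i + (∑ i ∈ S, (tripTollAt n T i - T i i)) / Dsep n T *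
      ((∑ h ∈ Finset.Icc 1 n, ∑ k ∈ Finset.Icc h n, T h k) - ∑ j ∈ Finset.Icc 1 n, T j j) := by
  simp only [SPS, if_pos hD]
  rw [Finset.sum_add_distrib, Finset.sum_div, Finset.sum_mul]

lemma SPS_sum' (n : ℕ) (T : ℕ → ℕ → ℝ) (S : Finset ℕ) (hD : ¬ 0 < Dsep n T) :
    ∑ i ∈ S, SPS n T i = ∑ i ∈ S, T i i := by
  simp only [SPS, if_neg hD]

lemma efficient (n : ℕ) (T : ℕ → ℕ → ℝ) (h0 : ¬ 0 < Dsep n T →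
      ∑ h ∈ Finset.Icc 1 n, ∑ k ∈ Finset.Icc h n, T h k = ∑ j ∈ Finset.Icc 1 n, T j j) :
    ∑ i ∈ Finset.Icc 1 n, SPS n T i = vSe n T (Finset.Icc 1 n) := by
  have hv : vSe n T (Finset.Icc 1 n) = ∑ h ∈ Finset.Icc 1 n, ∑ k ∈ Finset.Icc h n, T h k := by
    unfold vSe
    refine Finset.sum_congr rfl fun h hh => Finset.sum_congr rfl fun k hk => ?_
    rw [if_pos]
    rw [Finset.mem_Icc] at hh hk
    exact Finset.Icc_subset_Icc hh.1 hk.2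
  rw [hv]
  by_cases hD : 0 < Dsep n T
  · rw [SPS_sum n T _ hD]
    change _ + Dsep n T / Dsep n T * _ = _
    rw [div_self hD.ne']; ring
  · rw [SPS_sum' n T _ hD, h0 hD]

lemma I11 : Finset.Icc 1 1 = {1} := by decide
lemma I12 : Finset.Icc 1 2 = {1,2} := by decide
lemma I13 : Finset.Icc 1 3 = {1,2,3} := by decide
lemma I14 : Finset.Icc 1 4 = {1,2,3,4} := by decide
lemma I22 : Finset.Icc 2 2 = {2} := by decide
lemma I23 : Finset.Icc 2 3 = {2,3} := by decide
lemma I24 : Finset.Icc 2 4 = {2,3,4} := by decide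
lemma I33 : Finset.Icc 3 3 = {3} := by decide
lemma I34 : Finset.Icc 3 4 = {3,4} := by decide
lemma I44 : Finset.Icc 4 4 = {4} := by decide

lemma S2 (f : ℕ → ℝ) (a b : ℕ) (h : a ≠ b) : ∑ i ∈ ({a,b} : Finset ℕ), f i = f a + f b :=
  Finset.sum_pair h
lemma S123 (f : ℕ → ℝ) : ∑ i ∈ ({1,2,3} : Finset ℕ), f i = f 1 + f 2 + f 3 := by
  simp [add_assoc]
lemma S234 (f : ℕ → ℝ) : ∑ i ∈ ({2,3,4} : Finset ℕ), f i = f 2 + f 3 + f 4 := by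
  simp [add_assoc]
lemma S1234 (f : ℕ → ℝ) : ∑ i ∈ ({1,2,3,4} : Finset ℕ), f i = f 1 + f 2 + f 3 + f 4 := by
  simp [add_assoc]
lemma S12 (f : ℕ → ℝ) : ∑ i ∈ ({1,2} : Finset ℕ), f i = f 1 + f 2 := by simp
lemma S23 (f : ℕ → ℝ) : ∑ i ∈ ({2,3} : Finset ℕ), f i = f 2 + f 3 := by simp
lemma S34 (f : ℕ → ℝ) : ∑ i ∈ ({3,4} : Finset ℕ), f i = f 3 + f 4 := by simp

lemma core3 (T : ℕ → ℕ → ℝ) (hT : ∀ h k, 0 ≤ T h k) : InCore 3 (vSe 3 T) (SPS 3 T) := by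
  have a := hT 1 2
  have b := hT 2 3
  have d := hT 1 3
  have hDe : Dsep 3 T = 2 * (T 1 2 + T 2 3) + 3 * T 1 3 := by
    simp only [Dsep, tripTollAt, I11, I12, I13, I22, I23, I33, S12, S23, S123, Finset.sum_singleton]
    ring
  refine ⟨efficient 3 T fun hD => ?_, fun S hS => ?_⟩
  · rw [hDe] at hD
    simp only [I11, I12, I13, I22, I23, I33, S12, S23, S123, Finset.sum_singleton]
    linarith
  · by_cases hD : 0 < Dsep 3 T
    · rw [SPS_sum 3 T S hD]
      apply sps_div_helper _ _ _ _ _ hD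
      rw [hDe]
      rw [sum_subset_ite 3 S hS, sum_subset_ite 3 S hS]
      simp only [vSe, tripTollAt, I11, I12, I13, I22, I23, I33, S12, S23, S123,
        Finset.sum_singleton, Finset.insert_subset_iff, Finset.singleton_subset_iff]
      generalize T 1 2 = a, T 2 3 = b, T 1 3 = d at *
      by_cases h1 : 1 ∈ S <;> by_cases h2 : 2 ∈ S <;> by_cases h3 : 3 ∈ S <;>
      · simp only [h1, h2, h3, and_true, and_false, if_true, if_false]
        rw [← sub_nonneg]
        ring_nf
        try positivity
    · rw [SPS_sum' 3 T S hD, sum_subset_ite 3 S hS]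
      rw [hDe] at hD
      have a0 : T 1 2 = 0 := by linarith
      have b0 : T 2 3 = 0 := by linarith
      have d0 : T 1 3 = 0 := by linarith
      simp only [vSe, I11, I12, I13, I22, I23, I33, S12, S23, S123,
        Finset.sum_singleton, Finset.singleton_subset_iff, a0, b0, d0, ite_self]
      linarith

lemma core4 (T : ℕ → ℕ → ℝ) (hT : ∀ h k, 0 ≤ T h k) : InCore 4 (vSe 4 T) (SPS 4 T) := by
  have a := hT 1 2
  have b := hT 2 3
  have c := hT 3 4
  have d := hT 1 3
  have e := hT 2 4
  have f := hT 1 4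
  have hDe : Dsep 4 T = 2 * (T 1 2 + T 2 3 + T 3 4) + 3 * (T 1 3 + T 2 4) + 4 * T 1 4 := by
    simp only [Dsep, tripTollAt, I11, I12, I13, I14, I22, I23, I24, I33, I34, I44,
      S12, S23, S34, S123, S234, S1234, Finset.sum_singleton]
    ring
  refine ⟨efficient 4 T fun hD => ?_, fun S hS => ?_⟩
  · rw [hDe] at hD
    simp only [I14, I22, I23, I24, I33, I34, I44,
      S12, S23, S34, S123, S234, S1234, Finset.sum_singleton]
    linarith
  · by_cases hD : 0 < Dsep 4 T
    · rw [SPS_sum 4 T S hD]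
      apply sps_div_helper _ _ _ _ _ hD
      rw [hDe]
      rw [sum_subset_ite 4 S hS, sum_subset_ite 4 S hS]
      simp only [vSe, tripTollAt, I11, I12, I13, I14, I22, I23, I24, I33, I34, I44,
        S12, S23, S34, S123, S234, S1234,
        Finset.sum_singleton, Finset.insert_subset_iff, Finset.singleton_subset_iff]
      generalize T 1 2 = a, T 2 3 = b, T 3 4 = c, T 1 3 = d, T 2 4 = e, T 1 4 = f at *
      by_cases h1 : 1 ∈ S <;> by_cases h2 : 2 ∈ S <;> by_cases h3 : 3 ∈ S <;>
        by_cases h4 : 4 ∈ S <;>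
      · simp only [h1, h2, h3, h4, and_true, and_false, if_true, if_false]
        rw [← sub_nonneg]
        ring_nf
        try positivity
    · rw [SPS_sum' 4 T S hD, sum_subset_ite 4 S hS]
      rw [hDe] at hD
      have a0 : T 1 2 = 0 := by linarith
      have b0 : T 2 3 = 0 := by linarith
      have c0 : T 3 4 = 0 := by linarith
      have d0 : T 1 3 = 0 := by linarith
      have e0 : T 2 4 = 0 := by linarith
      have f0 : T 1 4 = 0 := by linarith
      simp only [vSe, I11, I12, I13, I14, I22, I23, I24, I33, I34, I44,
        S12, S23, S34, S123, S234, S1234,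
        Finset.sum_singleton, Finset.singleton_subset_iff, a0, b0, c0, d0, e0, f0, ite_self]
      linarith

/-- For highways with `3` or `4` segments the SPS allocation always belongs to
the core of the segments allocation game. -/
theorem SPS_in_core_small (n : ℕ) (hn : n = 3 ∨ n = 4) (T : ℕ → ℕ → ℝ)
    (hT : IsTollMatrix n T) :
    InCore n (vSe n T) (SPS n T) := by
  rcases hn with rfl | rfl
  · exact core3 T hT.1
  · exact core4 T hT.1
end

section
/- For every n ≥ 1, every toll matrix T, and every nonempty S ⊆ N, the Harsanyi dividend of the segments allocation game satisfies: Δ_{v^{Se}}(S) = t_{hk} if S = 𝒫([h,k]) for some h ≤ k, and Δ_{v^{Se}}(S) = 0 if S is not of this form (i.e., not a set of consecutive segments). -/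
open Finset

/-- The Harsanyi dividend `Δ_v(S) = Σ_{R ⊆ S} (−1)^{|S|−|R|} v(R)`. -/
def dividend (v : Finset ℕ → ℝ) (S : Finset ℕ) : ℝ :=
  ∑ R ∈ S.powerset, (-1 : ℝ) ^ (S.card - R.card) * v R

theorem dividend_unanimity_aux (A S : Finset ℕ) (t : ℝ) :
    ∑ R ∈ S.powerset, (-1 : ℝ) ^ (S.card - R.card) * (if A ⊆ R then t else 0)
      = if A = S then t else 0 := by
  by_cases hAS : A ⊆ S
  · have key := Finset.prod_add (fun _ : ℕ => (1 : ℝ)) (fun i => if i ∉ A then (-1 : ℝ) else 0) S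
    have h1 : ∏ i ∈ S, ((1 : ℝ) + (if i ∉ A then (-1 : ℝ) else 0)) = if A = S then 1 else 0 := by
      have : ∀ i ∈ S, ((1 : ℝ) + (if i ∉ A then (-1 : ℝ) else 0)) = if i ∈ A then 1 else 0 := by
        intro i _
        by_cases h : i ∈ A <;> simp [h]
      rw [Finset.prod_congr rfl this, Finset.prod_ite_zero, Finset.prod_const_one]
      have e : (∀ i ∈ S, i ∈ A) ↔ A = S :=
        ⟨fun h => Finset.Subset.antisymm hAS h, fun h => by subst h; exact fun _ h => h⟩
      simp only [e]
    rw [h1] at key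
    have h2 : ∀ R ∈ S.powerset, (-1 : ℝ) ^ (S.card - R.card) * (if A ⊆ R then t else 0)
        = ((∏ i ∈ R, (1 : ℝ)) * ∏ i ∈ S \ R, (if i ∉ A then (-1 : ℝ) else 0)) * t := by
      intro R hR
      rw [Finset.mem_powerset] at hR
      rw [Finset.prod_const_one, one_mul, Finset.prod_ite_zero, Finset.prod_const,
        Finset.card_sdiff_of_subset hR]
      have e : (∀ i ∈ S \ R, i ∉ A) ↔ A ⊆ R := by
        constructor
        · intro h i hi
          by_contra hc
          exact h i (Finset.mem_sdiff.2 ⟨hAS hi, hc⟩) hi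
        · intro h i hi hc
          exact (Finset.mem_sdiff.1 hi).2 (h hc)
      simp only [e]
      split_ifs <;> simp
    rw [Finset.sum_congr rfl h2, ← Finset.sum_mul, ← key]
    split_ifs <;> simp
  · rw [if_neg (fun h : A = S => hAS h.subset)]
    refine Finset.sum_eq_zero fun R hR => ?_
    rw [if_neg (fun h => hAS (h.trans (Finset.mem_powerset.1 hR))), mul_zero]

theorem dividend_vSe_aux (n : ℕ) (T : ℕ → ℕ → ℝ) (S : Finset ℕ) :
    dividend (vSe n T) S =
      ∑ h ∈ Finset.Icc 1 n, ∑ k ∈ Finset.Icc h n, if Finset.Icc h k = S then T h k else 0 := by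
  unfold dividend vSe
  simp only [Finset.mul_sum]
  rw [Finset.sum_comm]
  refine Finset.sum_congr rfl fun h _ => ?_
  rw [Finset.sum_comm]
  exact Finset.sum_congr rfl fun k _ => dividend_unanimity_aux _ _ _

theorem Icc_inj_aux {a b h k : ℕ} (hab : a ≤ b) (hhk : h ≤ k)
    (e : Finset.Icc a b = Finset.Icc h k) : a = h ∧ b = k := by
  have h1 := Finset.Icc_subset_Icc_iff hab |>.1 e.subset
  have h2 := Finset.Icc_subset_Icc_iff hhk |>.1 e.symm.subset
  omega

/-- The Harsanyi dividends of the segments allocation game: `Δ(𝒫([h,k])) = t_{hk}`,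
and `Δ(S) = 0` whenever `S` is not a set of consecutive segments. -/
theorem dividends_of_vSe (n : ℕ) (hn : 1 ≤ n) (T : ℕ → ℕ → ℝ)
    (hT : IsTollMatrix n T) :
    ∀ S ⊆ Finset.Icc 1 n, S.Nonempty →
      (∀ h k, 1 ≤ h → h ≤ k → k ≤ n → S = Finset.Icc h k →
        dividend (vSe n T) S = T h k) ∧
      ((¬ ∃ h k, 1 ≤ h ∧ h ≤ k ∧ k ≤ n ∧ S = Finset.Icc h k) →
        dividend (vSe n T) S = 0) := by
  intro S _ _
  rw [dividend_vSe_aux]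
  constructor
  · intro h k h1 hk kn hS
    subst hS
    rw [Finset.sum_eq_single h, Finset.sum_eq_single k]
    · simp
    · intro b hb hne
      rw [if_neg]
      exact fun e => hne (Icc_inj_aux (Finset.mem_Icc.1 hb).1 hk e).2
    · intro hc
      exact absurd (Finset.mem_Icc.2 ⟨hk, kn⟩) hc
    · intro a _ hne
      refine Finset.sum_eq_zero fun b hb => ?_
      rw [if_neg]
      exact fun e => hne (Icc_inj_aux (Finset.mem_Icc.1 hb).1 hk e).1
    · intro hc
      exact absurd (Finset.mem_Icc.2 ⟨h1, hk.trans kn⟩) hc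
  · intro hne
    refine Finset.sum_eq_zero fun a ha => Finset.sum_eq_zero fun b hb => ?_
    rw [if_neg]
    intro e
    rw [Finset.mem_Icc] at ha hb
    exact hne ⟨a, b, ha.1, hb.1, hb.2, e.symm⟩
end

section
/- For every n ≥ 1, the Segments Equal Sharing method f^{Se} satisfies efficiency, linearity, the inessential segment property, and weak segment symmetry; moreover, for every n ≥ 3, f^{Se} does not satisfy indifference to individual extensions. -/
open Finset

theorem SES_single_aux (n a c i : ℕ) (T : ℕ → ℕ → ℝ) (ha : 1 ≤ a) (hai : a ≤ i) (hic : i ≤ c)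
    (hc : c ≤ n) (hT : ∀ h k, 1 ≤ h → h ≤ k → k ≤ n → ¬(h = a ∧ k = c) → T h k = 0) :
    SES n T i = T a c / ((c : ℝ) - (a : ℝ) + 1) := by
  unfold SES
  rw [Finset.sum_eq_single a, Finset.sum_eq_single c]
  · intro k hk hne
    rw [Finset.mem_Icc] at hk
    rw [hT a k ha (by omega) hk.2 (by tauto), zero_div]
  · intro h
    exact absurd (Finset.mem_Icc.2 ⟨hic, hc⟩) h
  · intro h hh hne
    rw [Finset.mem_Icc] at hh
    refine Finset.sum_eq_zero fun k hk => ?_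
    rw [Finset.mem_Icc] at hk
    rw [hT h k hh.1 (by omega) hk.2 (by tauto), zero_div]
  · intro h
    exact absurd (Finset.mem_Icc.2 ⟨ha, hai⟩) h

/-- The SES method satisfies efficiency, linearity, the inessential segment
property and weak segment symmetry; for `n ≥ 3` it does not satisfy
indifference to individual extensions. -/
theorem SES_properties_and_failure (n : ℕ) (hn : 1 ≤ n) :
    (Efficient n (SES n) ∧ LinearMethod n (SES n) ∧ InessentialSegment n (SES n) ∧
      WeakSegmentSymmetric n (SES n)) ∧
    (3 ≤ n → ¬ IndiffToIndivExtensions n (SES n)) := by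
  refine ⟨⟨?_, ?_, ?_, ?_⟩, ?_⟩
  · intro T _
    unfold SES
    rw [Finset.sum_comm' (t' := Finset.Icc 1 n) (s' := fun h => Finset.Icc h n)
      (by intro x y; simp only [Finset.mem_Icc]; omega)]
    refine Finset.sum_congr rfl fun h hh => ?_
    rw [Finset.sum_comm' (t' := Finset.Icc h n) (s' := fun k => Finset.Icc h k)
      (by intro x y; simp only [Finset.mem_Icc]; omega)]
    refine Finset.sum_congr rfl fun k hk => ?_
    rw [Finset.mem_Icc] at hk
    have h1 : (h : ℝ) ≤ k := by exact_mod_cast hk.1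
    have h2 : (k : ℝ) - h + 1 ≠ 0 := by linarith
    rw [Finset.sum_const, Nat.card_Icc, nsmul_eq_mul, Nat.cast_sub (by omega)]
    push_cast
    field_simp
    ring
  · intro T T' _ _ b b' _ _ i _
    unfold SES
    simp only [Finset.mul_sum, ← Finset.sum_add_distrib]
    refine Finset.sum_congr rfl fun h _ => Finset.sum_congr rfl fun k _ => ?_
    ring
  · intro T _ i _ h0
    unfold SES
    refine Finset.sum_eq_zero fun h hh => Finset.sum_eq_zero fun k hk => ?_
    rw [Finset.mem_Icc] at hh hk
    rw [h0 h k hh.1 hh.2 hk.1 hk.2, zero_div]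
  · intro T _ h0 i hi j hj
    rw [Finset.mem_Icc] at hi hj
    rw [SES_single_aux n 1 n i T le_rfl hi.1 hi.2 le_rfl h0,
      SES_single_aux n 1 n j T le_rfl hj.1 hj.2 le_rfl h0]
  · intro h3 hI
    have h := (hI 1 2 le_rfl (by norm_num) (by omega)).2 (by omega) 1 (by simp) (by norm_num)
    rw [SES_single_aux n 1 3 1 _ le_rfl le_rfl (by norm_num) h3
        (by intro a c _ _ _ hne; simp [unitToll, hne]),
      SES_single_aux n 1 2 1 _ le_rfl le_rfl (by norm_num) (by omega)
        (by intro a c _ _ _ hne; simp [unitToll, hne])] at h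
    norm_num [unitToll] at h
end

section
/- For every n ≥ 1, the entrance method g defined by g_i(N,T) = Σ_{k=i}^{n} t_{ik} satisfies efficiency, the inessential segment property, linearity, and indifference to individual extensions; moreover, for every n ≥ 2, g does not satisfy weak segment symmetry. -/
open Finset

/-- The entrance method: segment `i` receives the toll collected from all the
users entering the highway at entrance `i`. -/
def entranceMethod (n : ℕ) (T : ℕ → ℕ → ℝ) (i : ℕ) : ℝ :=
  ∑ k ∈ Finset.Icc i n, T i k

theorem entranceMethod_unitToll (n a b i : ℕ) :
    entranceMethod n (unitToll a b) i = if i = a ∧ i ≤ b ∧ b ≤ n then 1 else 0 := by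
  unfold entranceMethod unitToll
  by_cases h : i = a
  · simp [h, Finset.sum_ite_eq']
  · simp [h]

/-- The entrance method satisfies efficiency, the inessential segment
property, linearity and indifference to individual extensions; for `n ≥ 2` it
does not satisfy weak segment symmetry. -/
theorem entrance_properties_and_failure (n : ℕ) (hn : 1 ≤ n) :
    (Efficient n (entranceMethod n) ∧ InessentialSegment n (entranceMethod n) ∧
      LinearMethod n (entranceMethod n) ∧
      IndiffToIndivExtensions n (entranceMethod n)) ∧
    (2 ≤ n → ¬ WeakSegmentSymmetric n (entranceMethod n)) := by
  refine ⟨⟨?_, ?_, ?_, ?_⟩, ?_⟩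
  · intro T _
    rfl
  · intro T _ i hi h
    rw [Finset.mem_Icc] at hi
    refine Finset.sum_eq_zero fun k hk => ?_
    rw [Finset.mem_Icc] at hk
    exact h i k hi.1 le_rfl hk.1 hk.2
  · intro T T' _ _ b b' _ _ i _
    simp only [entranceMethod, Finset.sum_add_distrib, Finset.mul_sum]
  · intro h k h1 hk kn
    refine ⟨fun h2 i hi hne => ?_, fun h2 i hi hne => ?_⟩
    · rw [Finset.mem_Icc] at hi
      rw [entranceMethod_unitToll, entranceMethod_unitToll, if_neg (by omega),
        if_neg (by omega)]
    · rw [Finset.mem_Icc] at hi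
      rw [entranceMethod_unitToll, entranceMethod_unitToll]
      congr 1
      apply propext
      omega
  · intro h2 hw
    have key := hw (unitToll 1 n) ⟨?_, ?_, ?_⟩ ?_ 1 (by simp; omega) 2 (by simp; omega)
    · rw [entranceMethod_unitToll, entranceMethod_unitToll, if_pos (by omega),
        if_neg (by omega)] at key
      exact one_ne_zero key
    · intro h k
      unfold unitToll
      split_ifs <;> norm_num
    · intro h k hk
      exact if_neg (by omega)
    · intro h k hk
      exact if_neg (by omega)
    · intro h k _ _ _ hne
      exact if_neg hne
end

section
/- For every n ≥ 1, the Segments Equal Sharing method f^{Se} satisfies sub-highway efficiency; moreover, for every n ≥ 3, f^{Se} does not satisfy toll component fairness. -/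
open Finset

/-- The SES method satisfies sub-highway efficiency; for `n ≥ 3` it does not
satisfy toll component fairness. -/
theorem SES_subhighway_not_componentFair (n : ℕ) (hn : 1 ≤ n) :
    SubHighwayEfficient n (SES n) ∧
    (3 ≤ n → ¬ TollComponentFairness n (SES n)) := by
  constructor
  · intro T _ a b hsub
    obtain ⟨ha, hab, hb, hz⟩ := hsub
    have h1 : ∀ i ∈ Finset.Icc a b, SES n T i =
        ∑ h ∈ Finset.Icc a i, ∑ k ∈ Finset.Icc i b, T h k / ((k : ℝ) - (h : ℝ) + 1) := by
      intro i hi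
      rw [Finset.mem_Icc] at hi
      have key : ∀ h k, 1 ≤ h → h ≤ i → i ≤ k → k ≤ n → (h < a ∨ b < k) → T h k = 0 := by
        intro h k h1 h2 h3 h4 h5
        refine hz h k h1 (h2.trans h3) h4 ⟨i, ?_⟩ ?_
        · simp only [Finset.mem_inter, Finset.mem_Icc]; omega
        · simp only [Finset.mem_Icc]; omega
      unfold SES
      symm
      trans ∑ h ∈ Finset.Icc a i, ∑ k ∈ Finset.Icc i n, T h k / ((k : ℝ) - (h : ℝ) + 1)
      · refine Finset.sum_congr rfl fun h hh => ?_
        rw [Finset.mem_Icc] at hh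
        refine Finset.sum_subset (Finset.Icc_subset_Icc le_rfl hb) fun k hk hk' => ?_
        rw [Finset.mem_Icc] at hk hk'
        rw [key h k (by omega) (by omega) (by omega) (by omega) (by omega), zero_div]
      · refine Finset.sum_subset (Finset.Icc_subset_Icc ha le_rfl) fun h hh hh' => ?_
        rw [Finset.mem_Icc] at hh hh'
        refine Finset.sum_eq_zero fun k hk => ?_
        rw [Finset.mem_Icc] at hk
        rw [key h k (by omega) (by omega) (by omega) (by omega) (by omega), zero_div]
    rw [Finset.sum_congr rfl h1]
    rw [Finset.sum_comm' (t' := Finset.Icc a b) (s' := fun h => Finset.Icc h b)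
      (by intro x y; simp only [Finset.mem_Icc]; omega)]
    refine Finset.sum_congr rfl fun h _ => ?_
    rw [Finset.sum_comm' (t' := Finset.Icc h b) (s' := fun k => Finset.Icc h k)
      (by intro x y; simp only [Finset.mem_Icc]; omega)]
    refine Finset.sum_congr rfl fun k hk => ?_
    rw [Finset.mem_Icc] at hk
    have hk1 : (h : ℝ) ≤ k := by exact_mod_cast hk.1
    rw [Finset.sum_const, Nat.card_Icc, nsmul_eq_mul, Nat.cast_sub (by omega)]
    push_cast
    have : (k : ℝ) - h + 1 ≠ 0 := by linarith
    field_simp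
    ring
  · intro h3 hf
    let T : ℕ → ℕ → ℝ := fun h k => if h = 1 ∧ k = 2 then 1 else 0
    have hT : ∀ h k, ¬ (h = 1 ∧ k = 2) → T h k = 0 := fun h k hh => if_neg hh
    have hT1 : T 1 2 = 1 := if_pos ⟨rfl, rfl⟩
    have hS0 : ∀ i, SES n (fun _ _ => 0) i = 0 := by intro i; simp [SES]
    have hS : ∀ i, 1 ≤ i → i ≤ 2 → SES n T i = 1 / 2 := by
      intro i hi1 hi2
      unfold SES
      rw [Finset.sum_eq_single 1, Finset.sum_eq_single 2]
      · rw [hT1]; norm_num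
      · intro k _ hk; rw [hT _ _ (by omega), zero_div]
      · intro h; exact absurd (Finset.mem_Icc.2 ⟨hi2, by omega⟩) h
      · intro k _ hk
        exact Finset.sum_eq_zero fun l _ => by rw [hT _ _ (by omega), zero_div]
      · intro h; exact absurd (Finset.mem_Icc.2 ⟨le_rfl, hi1⟩) h
    have hS3 : ∀ i, 3 ≤ i → SES n T i = 0 := by
      intro i hi
      unfold SES
      refine Finset.sum_eq_zero fun h _ => Finset.sum_eq_zero fun k hk => ?_
      rw [Finset.mem_Icc] at hk
      rw [hT _ _ (by omega), zero_div]
    have := hf T (fun _ _ => 0)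
      ⟨fun h k => by dsimp only [T]; split_ifs <;> norm_num, fun h k _ => hT _ _ (by omega),
        fun h k _ => hT _ _ (by omega)⟩
      ⟨fun _ _ => le_rfl, fun _ _ _ => rfl, fun _ _ _ => rfl⟩ 1 le_rfl (by omega)
      (fun h k _ _ _ => ⟨fun _ => (hT _ _ (by omega)).symm, fun _ _ => rfl⟩)
    simp only [hS0, sub_zero] at this
    rw [Finset.Icc_self, Finset.sum_singleton, hS 1 le_rfl (by norm_num),
      Finset.sum_eq_single 2, hS 2 (by norm_num) le_rfl] at this
    · have hn3 : (3 : ℝ) ≤ n := by exact_mod_cast h3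
      have hne : (n : ℝ) - 1 ≠ 0 := by linarith
      push_cast at this
      field_simp at this
      linarith
    · intro k hk hk2
      rw [Finset.mem_Icc] at hk
      exact hS3 k (by omega)
    · intro h; exact absurd (Finset.mem_Icc.2 ⟨le_rfl, by omega⟩) h
end
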